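/- arXiv:1408.0314 — 8 statements merged into one kernel-verified Lean document; each statement's English description precedes it below -/
import Mathlib

section
/- Let Σ = F⁻¹({0}) be the zero level set of a smooth function F : ℝ³ → ℝ whose gradient is nonvanishing on Σ, let M be the medial axis of Σ and f the local feature size. If q and q' are two points of Σ with dist(q,q') ≤ ε·f(q) for some ε with 0 < ε ≤ 1/3, then the angle between the unit normals n_q and n_{q'} to Σ satisfies ∠(n_q, n_{q'}) ≤ ε/(1-ε). -/
open Metric Set

/-- The medial axis of a set `S ⊆ ℝ³`: the closure of the set of points having
more than one nearest point in `S`. -/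
noncomputable def medialAxis (S : Set (EuclideanSpace ℝ (Fin 3))) :
    Set (EuclideanSpace ℝ (Fin 3)) :=
  closure {x | ∃ y ∈ S, ∃ z ∈ S, y ≠ z ∧
    dist x y = Metric.infDist x S ∧ dist x z = Metric.infDist x S}

section

variable {E : Type*} [NormedAddCommGroup E] [InnerProductSpace ℝ E]

/-- Moving away from the unique nearest point `p` of a compact set increases the distance to the
set at a rate arbitrarily close to one. -/
lemma exists_infDist_add_smul_gt {S : Set E} (hS : IsCompact S) {x p : E} (hp : p ∈ S)
    (hxp : dist x p = infDist x S) (hx : 0 < infDist x S)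
    (huniq : ∀ y ∈ S, dist x y = infDist x S → y = p) {k : ℝ} (hk : k < 1) :
    ∃ h₀ > 0, ∀ h, 0 < h → h ≤ h₀ →
      infDist x S + k * h < infDist (x + h • ((infDist x S)⁻¹ • (x - p))) S := by
  set d := infDist x S
  set u := d⁻¹ • (x - p) with hu
  have hunorm : ‖u‖ = 1 := by
    rw [hu, norm_smul, norm_inv, Real.norm_of_nonneg hx.le, ← dist_eq_norm, hxp]
    exact inv_mul_cancel₀ hx.ne'
  have hxu : x - p = d • u := by rw [hu, smul_inv_smul₀ hx.ne']
  have hSne : S.Nonempty := ⟨p, hp⟩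
  have hfar : ∃ h₀ > 0, ∀ y ∈ S, inner ℝ (x - y) u ≤ k * ‖x - y‖ → d + 2 * h₀ ≤ dist x y := by
    have hK : IsCompact (S ∩ {y | inner ℝ (x - y) u ≤ k * ‖x - y‖}) :=
      hS.inter_right (isClosed_le (by fun_prop) (by fun_prop))
    rcases (S ∩ {y | inner ℝ (x - y) u ≤ k * ‖x - y‖}).eq_empty_or_nonempty with hempty | hne
    · refine ⟨1, one_pos, fun y hy hy' => ?_⟩
      have hmem : y ∈ S ∩ {y | inner ℝ (x - y) u ≤ k * ‖x - y‖} := ⟨hy, hy'⟩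
      rw [hempty] at hmem
      exact hmem.elim
    · obtain ⟨z, ⟨hzS, hz⟩, hzmin⟩ := hK.exists_infDist_eq_dist hne x
      have hzne : dist x z ≠ d := by
        intro h
        rw [huniq z hzS h, mem_ofPred_eq, hxu, real_inner_smul_left, real_inner_self_eq_norm_sq,
          norm_smul d u, hunorm, Real.norm_of_nonneg hx.le] at hz
        nlinarith
      have hzgt : d < dist x z := lt_of_le_of_ne (infDist_le_dist_of_mem hzS) hzne.symm
      refine ⟨(dist x z - d) / 2, by linarith, fun y hy hy' => ?_⟩
      have : infDist x (S ∩ {y | inner ℝ (x - y) u ≤ k * ‖x - y‖}) ≤ dist x y :=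
        infDist_le_dist_of_mem ⟨hy, hy'⟩
      linarith
  obtain ⟨h₀, hh₀, hfar⟩ := hfar
  refine ⟨h₀, hh₀, fun h hpos hle => ?_⟩
  obtain ⟨y, hy, hymin⟩ := hS.exists_infDist_eq_dist hSne (x + h • u)
  rw [hymin]
  have hsplit : x + h • u - y = (x - y) + h • u := by abel
  by_cases hyk : inner ℝ (x - y) u ≤ k * ‖x - y‖
  · have h1 := hfar y hy hyk
    have h2 : dist x y ≤ dist x (x + h • u) + dist (x + h • u) y := dist_triangle _ _ _
    rw [dist_self_add_right, norm_smul, hunorm, Real.norm_of_nonneg hpos.le] at h2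
    nlinarith
  · push Not at hyk
    have hdy : d ≤ ‖x - y‖ := by
      rw [← dist_eq_norm]
      exact infDist_le_dist_of_mem hy
    have hypos : 0 < ‖x - y‖ := hx.trans_le hdy
    have hinner : inner ℝ (x - y) (x + h • u - y) ≤ ‖x - y‖ * ‖x + h • u - y‖ :=
      real_inner_le_norm _ _
    rw [hsplit, inner_add_right, real_inner_smul_right, real_inner_self_eq_norm_sq, ← hsplit]
      at hinner
    rw [dist_eq_norm]
    have : ‖x - y‖ * (‖x - y‖ + k * h) < ‖x - y‖ * ‖x + h • u - y‖ := by nlinarith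
    have := lt_of_mul_lt_mul_left this hypos.le
    linarith

/-- If all points of a small ball around `c` have a unique nearest point in the compact set `S`,
then the segment from the nearest point of `c` to `c` can be prolonged by the radius of the ball
without changing the nearest point of its endpoint. -/
lemma infDist_prolong [ProperSpace E] {S : Set E} (hS : IsCompact S) {p u : E} (hp : p ∈ S)
    (hu : ‖u‖ = 1) {t s : ℝ} (hs : 0 < s) (hst : s < t) (ht : t ≤ infDist (p + t • u) S)
    (huniq : ∀ x ∈ closedBall (p + t • u) s, ∀ y ∈ S, ∀ z ∈ S,
      dist x y = infDist x S → dist x z = infDist x S → y = z) :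
    t + s ≤ infDist (p + (t + s) • u) S := by
  set c := p + t • u with hc
  have hcp : dist c p = t := by
    rw [hc, dist_self_add_left, norm_smul, hu, Real.norm_of_nonneg (hs.trans hst).le, mul_one]
  have hdist : Continuous fun x => infDist x S := continuous_infDist_pt S
  have hball : (closedBall c s).Nonempty := ⟨c, mem_closedBall_self hs.le⟩
  have hK : IsCompact (closedBall c s) := isCompact_closedBall c s
  obtain ⟨x₀, hx₀, hmax⟩ := hK.exists_isMaxOn hball hdist.continuousOn
  have hslope : ∀ k, 0 < k → k < 1 → t + k * s ≤ infDist x₀ S := by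
    intro k hk0 hk1
    obtain ⟨x, hx, hxmax⟩ := hK.exists_isMaxOn hball
      (f := fun x => infDist x S - k * dist x c) (by fun_prop)
    have hxc : infDist c S - k * dist c c ≤ infDist x S - k * dist x c :=
      hxmax (mem_closedBall_self hs.le)
    rw [dist_self] at hxc
    rw [mem_closedBall] at hx
    have hxs : dist x c = s := by
      by_contra hne
      have hlt : dist x c < s := lt_of_le_of_ne hx hne
      have hxpos : 0 < infDist x S := by nlinarith [dist_nonneg (x := x) (y := c)]
      obtain ⟨y, hy, hyx⟩ := hS.exists_infDist_eq_dist ⟨p, hp⟩ x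
      obtain ⟨h₀, hh₀, hinc⟩ := exists_infDist_add_smul_gt hS hy hyx.symm hxpos
        (fun z hz hzx => huniq x hx z hz y hy hzx hyx.symm) hk1
      set v := (infDist x S)⁻¹ • (x - y) with hv
      have hvnorm : ‖v‖ = 1 := by
        rw [hv, norm_smul, norm_inv, Real.norm_of_nonneg hxpos.le, ← dist_eq_norm, ← hyx]
        exact inv_mul_cancel₀ hxpos.ne'
      have hhpos : 0 < min h₀ (s - dist x c) := lt_min hh₀ (by linarith)
      have hh := hinc _ hhpos (min_le_left _ _)
      have hle := min_le_right h₀ (s - dist x c)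
      set h := min h₀ (s - dist x c)
      have htri : dist (x + h • v) c ≤ h + dist x c := by
        refine (dist_triangle _ x _).trans_eq ?_
        rw [dist_self_add_left, norm_smul, hvnorm, Real.norm_of_nonneg hhpos.le, mul_one]
      have hmem : x + h • v ∈ closedBall c s := by
        rw [mem_closedBall]
        linarith
      have hle' : infDist (x + h • v) S - k * dist (x + h • v) c ≤ infDist x S - k * dist x c :=
        hxmax hmem
      nlinarith
    have : infDist x S ≤ infDist x₀ S := hmax (mem_closedBall.2 hx)
    rw [hxs] at hxc
    linarith
  have hx₀ge : t + s ≤ infDist x₀ S := by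
    refine le_of_forall_pos_lt_add fun η hη => ?_
    have hk := hslope (max (1 / 2) (1 - η / (2 * s)))
      (lt_max_of_lt_left (by norm_num)) (max_lt (by norm_num) (by
        have : 0 < η / (2 * s) := by positivity
        linarith))
    have h1 : (1 - η / (2 * s)) * s ≤ max (1 / 2) (1 - η / (2 * s)) * s :=
      mul_le_mul_of_nonneg_right (le_max_right _ _) hs.le
    have h2 : (1 - η / (2 * s)) * s = s - η / 2 := by field_simp
    linarith
  rw [mem_closedBall] at hx₀
  have hx₀p : infDist x₀ S ≤ dist x₀ p := infDist_le_dist_of_mem hp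
  have htri : dist x₀ p ≤ dist x₀ c + dist c p := dist_triangle _ _ _
  have hx₀c : ‖x₀ - c‖ = s := by
    rw [← dist_eq_norm]
    linarith
  have hcp' : c - p = t • u := by rw [hc, add_sub_cancel_left]
  have hray : SameRay ℝ (x₀ - c) (c - p) := by
    rw [sameRay_iff_norm_add, sub_add_sub_cancel, ← dist_eq_norm, ← dist_eq_norm, ← dist_eq_norm]
    linarith
  have hx₀eq : x₀ = p + (t + s) • u := by
    rw [sameRay_iff_norm_smul_eq, hx₀c, ← dist_eq_norm c p, hcp, hcp', smul_comm] at hray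
    have hx₀cu := smul_right_injective E (hs.trans hst).ne' hray
    rw [add_smul, ← add_assoc, ← hc, hx₀cu, add_sub_cancel]
  rwa [← hx₀eq]

/-- A twice continuously differentiable function differs from its first order expansion by a
quadratic error. -/
lemma exists_quadratic_bound {F : E → ℝ} (hF : ContDiff ℝ 2 F) (p : E) :
    ∃ C > 0, ∃ δ > 0, ∀ y, dist y p < δ →
      |F y - F p - fderiv ℝ F p (y - p)| ≤ C * ‖y - p‖ ^ 2 := by
  have hF' : ContDiff ℝ 1 (fderiv ℝ F) := hF.fderiv_right (by norm_num)
  obtain ⟨K, t, ht, hK⟩ := hF'.contDiffAt.exists_lipschitzOnWith (x := p)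
  obtain ⟨δ, hδ, hball⟩ := Metric.mem_nhds_iff.1 ht
  refine ⟨K + 1, by positivity, δ, hδ, fun y hy => ?_⟩
  have hsub : closedBall p (dist y p) ⊆ t := (closedBall_subset_ball hy).trans hball
  have hmean := Convex.norm_image_sub_le_of_norm_fderiv_le' (𝕜 := ℝ) (f := F)
    (φ := fderiv ℝ F p) (C := K * dist y p) (s := closedBall p (dist y p)) (x := p) (y := y)
    (fun x _ => (hF.differentiable (by norm_num)) x)
    (fun x hx => by
      rw [← dist_eq_norm]
      exact (hK.dist_le_mul x (hsub hx) p (hsub (mem_closedBall_self dist_nonneg))).trans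
        (mul_le_mul_of_nonneg_left hx K.2))
    (convex_closedBall _ _) (mem_closedBall_self dist_nonneg) (mem_closedBall.2 le_rfl)
  rw [Real.norm_eq_abs, dist_eq_norm] at hmean
  nlinarith [sq_nonneg ‖y - p‖]

/-- A regular level set has a tangent ball on either side of each of its points. -/
lemma exists_tangent_ball {F : E → ℝ} (hF : ContDiff ℝ 2 F) {p u : E} (hp : F p = 0)
    (hu : ‖u‖ = 1) {a : ℝ} (ha : a ≠ 0) (hFu : ∀ v, fderiv ℝ F p v = a * inner ℝ u v) :
    ∃ t₀ > 0, ∀ t, 0 < t → t ≤ t₀ → t ≤ infDist (p + t • u) (F ⁻¹' {0}) := by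
  obtain ⟨C, hC, δ, hδ, hquad⟩ := exists_quadratic_bound hF p
  have ha' : 0 < |a| := abs_pos.2 ha
  refine ⟨min (δ / 2) (|a| / (2 * C)), by positivity, fun t ht htle => ?_⟩
  have ht1 : t ≤ δ / 2 := htle.trans (min_le_left _ _)
  have ht2 : t * (2 * C) ≤ |a| := (le_div_iff₀ (by positivity)).1 (htle.trans (min_le_right _ _))
  refine (le_infDist ⟨p, hp⟩).2 fun y hy => ?_
  have hy0 : F y = 0 := hy
  rcases lt_or_ge (dist y p) δ with hyδ | hyδ
  · have hq := hquad y hyδ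
    rw [hy0, hp, hFu, sub_zero, zero_sub, abs_neg, abs_mul] at hq
    have hkey : 2 * t * inner ℝ u (y - p) ≤ ‖y - p‖ ^ 2 := by
      have h1 : 2 * t * |inner ℝ u (y - p)| ≤ ‖y - p‖ ^ 2 := by
        have h2 : |a| * (2 * t * |inner ℝ u (y - p)|) ≤ |a| * ‖y - p‖ ^ 2 := by
          have h3 := mul_le_mul_of_nonneg_left hq (by positivity : 0 ≤ 2 * t)
          have h4 := mul_le_mul_of_nonneg_right ht2 (sq_nonneg ‖y - p‖)
          linarith
        exact le_of_mul_le_mul_left h2 ha'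
      exact (mul_le_mul_of_nonneg_left (le_abs_self _) (by positivity)).trans h1
    have hexp : dist (p + t • u) y ^ 2 = t ^ 2 - 2 * t * inner ℝ u (y - p) + ‖y - p‖ ^ 2 := by
      rw [dist_eq_norm, show p + t • u - y = t • u - (y - p) by abel, norm_sub_sq_real, norm_smul,
        hu, real_inner_smul_left, Real.norm_of_nonneg ht.le]
      ring
    exact le_of_sq_le_sq (by linarith) dist_nonneg
  · have htri : dist y p ≤ dist y (p + t • u) + dist (p + t • u) p := dist_triangle _ _ _
    rw [dist_self_add_left, norm_smul, hu, Real.norm_of_nonneg ht.le,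
      dist_comm y (p + t • u)] at htri
    linarith

/-- The center of an empty tangent ball on the side where `F` increases lies in `{F > 0}`. -/
lemma pos_of_tangent_ball {F : E → ℝ} (hF : ContDiff ℝ 2 F) {p u : E} (hp : F p = 0)
    (hu : ‖u‖ = 1) (hFu : 0 < fderiv ℝ F p u) {r : ℝ} (hr : 0 < r)
    (hball : r ≤ infDist (p + r • u) (F ⁻¹' {0})) : 0 < F (p + r • u) := by
  obtain ⟨C, hC, δ, hδ, hquad⟩ := exists_quadratic_bound hF p
  obtain ⟨t, ht, htr⟩ : ∃ t > 0, t ≤ r ∧ t < δ ∧ t * C < fderiv ℝ F p u := by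
    refine ⟨min r (min (δ / 2) (fderiv ℝ F p u / (2 * C))), by positivity, min_le_left _ _, ?_, ?_⟩
    · exact ((min_le_right _ _).trans (min_le_left _ _)).trans_lt (half_lt_self hδ)
    · refine (lt_div_iff₀ hC).1 (((min_le_right _ _).trans (min_le_right _ _)).trans_lt ?_)
      gcongr
      linarith
  obtain ⟨htr, htδ, htC⟩ := htr
  have hFt : 0 < F (p + t • u) := by
    have hnorm : ‖t • u‖ = t := by rw [norm_smul, hu, Real.norm_of_nonneg ht.le, mul_one]
    have hq := hquad (p + t • u) (by rwa [dist_self_add_left, hnorm])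
    rw [add_sub_cancel_left, hnorm, hp, map_smul, smul_eq_mul] at hq
    have := (abs_le.1 hq).1
    nlinarith
  by_contra! hneg
  have hcont : ContinuousOn (fun s : ℝ => F (p + s • u)) (Icc t r) :=
    (hF.continuous.comp (by fun_prop)).continuousOn
  obtain ⟨s, hs, hs0⟩ := intermediate_value_Icc' htr hcont ⟨hneg, hFt.le⟩
  have hle : infDist (p + r • u) (F ⁻¹' {0}) ≤ dist (p + r • u) (p + s • u) :=
    infDist_le_dist_of_mem hs0
  rw [dist_add_left, dist_eq_norm, ← sub_smul, norm_smul, hu,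
    Real.norm_of_nonneg (sub_nonneg.2 hs.2)] at hle
  linarith [hs.1]

/-- Empty balls around points on opposite sides of a level set have disjoint interiors. -/
lemma infDist_add_infDist_le_dist {F : E → ℝ} (hF : Continuous F) {a b : E} (ha : 0 < F a)
    (hb : F b < 0) : infDist a (F ⁻¹' {0}) + infDist b (F ⁻¹' {0}) ≤ dist a b := by
  obtain ⟨z, hz, hz0⟩ := (convex_segment b a).isPreconnected.intermediate_value
    (left_mem_segment ℝ b a) (right_mem_segment ℝ b a) hF.continuousOn ⟨hb.le, ha.le⟩
  have hsum := (mem_segment_iff_wbtw.1 hz).dist_add_dist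
  have h1 : infDist a (F ⁻¹' {0}) ≤ dist a z := infDist_le_dist_of_mem hz0
  have h2 : infDist b (F ⁻¹' {0}) ≤ dist b z := infDist_le_dist_of_mem hz0
  rw [dist_comm b a, dist_comm z a] at hsum
  linarith

/-- Two pairs of crosswise disjoint tangent balls force their axes to be almost parallel. -/
lemma mul_one_sub_inner_le {p q u v : E} (hu : ‖u‖ = 1) (hv : ‖v‖ = 1) {r s : ℝ}
    (hr : 0 ≤ r) (hs : 0 ≤ s)
    (h₁ : r + s ≤ dist (p + r • u) (q + s • -v)) (h₂ : r + s ≤ dist (q + s • v) (p + r • -u)) :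
    2 * (r * s) * (1 - inner ℝ u v) ≤ dist p q ^ 2 := by
  rw [dist_eq_norm] at *
  rw [show p + r • u - (q + s • -v) = (p - q) + (r • u + s • v) by
    rw [smul_neg]; abel] at h₁
  rw [show q + s • v - (p + r • -u) = -((p - q) - (r • u + s • v)) by
    rw [smul_neg]; abel, norm_neg] at h₂
  have hpar := parallelogram_law_with_norm ℝ (p - q) (r • u + s • v)
  have hexp : ‖r • u + s • v‖ * ‖r • u + s • v‖ = r ^ 2 + 2 * (r * s) * inner ℝ u v + s ^ 2 := by
    rw [← sq, norm_add_sq_real, norm_smul, norm_smul, hu, hv, real_inner_smul_left,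
      real_inner_smul_right, mul_one, mul_one, Real.norm_eq_abs, Real.norm_eq_abs, sq_abs, sq_abs]
    ring
  have hsq₁ := mul_self_le_mul_self (by positivity) h₁
  have hsq₂ := mul_self_le_mul_self (by positivity) h₂
  nlinarith

end

/-- The ball tangent to a regular level set at `p` whose radius is the local feature size of `p`
contains no point of the level set in its interior. -/
lemma infDist_medialAxis_le_infDist {F : EuclideanSpace ℝ (Fin 3) → ℝ} (hF : ContDiff ℝ 2 F)
    (hcomp : IsCompact (F ⁻¹' {0})) {p u : EuclideanSpace ℝ (Fin 3)} (hp : F p = 0)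
    (hu : ‖u‖ = 1) {a : ℝ} (ha : a ≠ 0) (hFu : ∀ v, fderiv ℝ F p v = a * inner ℝ u v)
    (hR : 0 < infDist p (medialAxis (F ⁻¹' {0}))) :
    infDist p (medialAxis (F ⁻¹' {0})) ≤
      infDist (p + infDist p (medialAxis (F ⁻¹' {0})) • u) (F ⁻¹' {0}) := by
  set S := F ⁻¹' {0}
  set R := infDist p (medialAxis S)
  obtain ⟨t₀, ht₀, hloc⟩ := exists_tangent_ball hF hp hu ha hFu
  have hT : IsCompact (Icc 0 R ∩ {t | t ≤ infDist (p + t • u) S}) :=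
    isCompact_Icc.inter_right
      (isClosed_le continuous_id ((continuous_infDist_pt S).comp (by fun_prop)))
  have hmem : min t₀ R ∈ Icc 0 R ∩ {t | t ≤ infDist (p + t • u) S} :=
    ⟨⟨by positivity, min_le_right _ _⟩, hloc _ (by positivity) (min_le_left _ _)⟩
  obtain ⟨τ, ⟨⟨-, hτR⟩, hτ⟩, hmax⟩ := hT.exists_isGreatest ⟨_, hmem⟩
  rcases hτR.eq_or_lt with rfl | hlt
  · exact hτ
  exfalso
  have hτpos : 0 < τ := (lt_min ht₀ hR).trans_le (hmax hmem)
  have hs : 0 < min (τ / 2) ((R - τ) / 2) := lt_min (by linarith) (by linarith)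
  have hs1 := min_le_left (τ / 2) ((R - τ) / 2)
  have hs2 := min_le_right (τ / 2) ((R - τ) / 2)
  set s := min (τ / 2) ((R - τ) / 2)
  have hext := infDist_prolong hcomp hp hu hs (by linarith) hτ fun x hx y hy z hz hxy hxz => by
    by_contra hne
    have hxM : x ∈ medialAxis S := subset_closure ⟨y, hy, z, hz, hne, hxy, hxz⟩
    have h1 : R ≤ dist p x := infDist_le_dist_of_mem hxM
    have h2 : dist p x ≤ dist p (p + τ • u) + dist (p + τ • u) x := dist_triangle _ _ _
    rw [dist_self_add_right, norm_smul, hu, Real.norm_of_nonneg hτpos.le] at h2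
    rw [mem_closedBall, dist_comm] at hx
    linarith
  have := hmax ⟨⟨by linarith, by linarith⟩, hext⟩
  linarith

/-- Both balls tangent at `p` with radius the local feature size, with their sides. -/
lemma tangent_balls_of_gradient_ne_zero {F : EuclideanSpace ℝ (Fin 3) → ℝ} (hF : ContDiff ℝ 2 F)
    (hcomp : IsCompact (F ⁻¹' {0})) {p : EuclideanSpace ℝ (Fin 3)} (hp : F p = 0)
    (hgrad : gradient F p ≠ 0) {r : ℝ} (hr : r = infDist p (medialAxis (F ⁻¹' {0})))
    (hr0 : 0 < r) :
    (0 < F (p + r • (‖gradient F p‖⁻¹ • gradient F p)) ∧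
      r ≤ infDist (p + r • (‖gradient F p‖⁻¹ • gradient F p)) (F ⁻¹' {0})) ∧
    (F (p + r • -(‖gradient F p‖⁻¹ • gradient F p)) < 0 ∧
      r ≤ infDist (p + r • -(‖gradient F p‖⁻¹ • gradient F p)) (F ⁻¹' {0})) := by
  have hG : 0 < ‖gradient F p‖ := norm_pos_iff.2 hgrad
  set u := ‖gradient F p‖⁻¹ • gradient F p with hu
  have hunorm : ‖u‖ = 1 := norm_smul_inv_norm hgrad
  have hFu : ∀ v, fderiv ℝ F p v = ‖gradient F p‖ * inner ℝ u v := fun v => by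
    rw [hu, real_inner_smul_left, mul_inv_cancel_left₀ hG.ne', inner_gradient_left]
  have hFuu : fderiv ℝ F p u = ‖gradient F p‖ := by
    rw [hFu, real_inner_self_eq_norm_sq, hunorm, one_pow, mul_one]
  subst hr
  have hpos := infDist_medialAxis_le_infDist hF hcomp hp hunorm hG.ne' hFu hr0
  have hneg := infDist_medialAxis_le_infDist hF hcomp hp (u := -u) (by rwa [norm_neg])
    (neg_ne_zero.2 hG.ne') (fun v => by rw [hFu, inner_neg_left, neg_mul_neg]) hr0
  refine ⟨⟨pos_of_tangent_ball hF hp hunorm (by rwa [hFuu]) hr0 hpos, hpos⟩, ?_, hneg⟩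
  have hpre : (-F) ⁻¹' {0} = F ⁻¹' {0} := by
    ext x
    simp
  have hnegF := pos_of_tangent_ball (F := -F) hF.neg (p := p) (u := -u) (by simp [hp])
    (by rwa [norm_neg]) (by
      rw [fderiv_neg, neg_apply, map_neg, neg_neg, hFuu]
      exact hG) hr0 (by rwa [hpre])
  simpa using hnegF

lemma cos_div_one_sub_le {ε : ℝ} (hε0 : 0 < ε) (hε : ε ≤ 1 / 3) :
    Real.cos (ε / (1 - ε)) ≤ 1 - ε ^ 2 / (2 * (1 - ε)) := by
  set a := ε / (1 - ε) with ha
  have h1 : 0 < 1 - ε := by linarith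
  have ha0 : 0 < a := div_pos hε0 h1
  have hεa : a * (1 - ε) = ε := div_mul_cancel₀ _ h1.ne'
  have ha1 : a ≤ 1 / 2 := by
    rw [ha, div_le_iff₀ h1]
    linarith
  have hb := (abs_le.1 (Real.cos_bound (abs_le.2 ⟨by linarith, by linarith⟩ : |a| ≤ 1))).2
  rw [abs_of_pos ha0] at hb
  have hrw : ε ^ 2 / (2 * (1 - ε)) = a ^ 2 / 2 - a ^ 2 * ε / 2 := by
    rw [ha]
    field_simp
  have haε : a * a ≤ ε := by nlinarith
  rw [hrw]
  nlinarith [mul_le_mul_of_nonneg_left haε (sq_nonneg a), mul_pos (pow_pos ha0 2) hε0]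

/-- Normal variation theorem: if `q, q' ∈ Σ` with `dist q q' ≤ ε · f q`,
`0 < ε ≤ 1/3`, then the angle between the unit normals is at most `ε/(1-ε)`. -/
theorem normal_variation
    (F : EuclideanSpace ℝ (Fin 3) → ℝ) (hF : ContDiff ℝ (⊤ : ℕ∞) F)
    (S : Set (EuclideanSpace ℝ (Fin 3))) (hS : S = F ⁻¹' {0})
    (hScomp : IsCompact S)
    (hgrad : ∀ p ∈ S, gradient F p ≠ 0)
    (M : Set (EuclideanSpace ℝ (Fin 3))) (hM : M = medialAxis S)
    (hMne : M.Nonempty)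
    (f : EuclideanSpace ℝ (Fin 3) → ℝ) (hf : ∀ x, f x = Metric.infDist x M)
    (q q' : EuclideanSpace ℝ (Fin 3)) (hq : q ∈ S) (hq' : q' ∈ S)
    (ε : ℝ) (hε0 : 0 < ε) (hε : ε ≤ 1/3)
    (hd : dist q q' ≤ ε * f q) :
    InnerProductGeometry.angle
      ((‖gradient F q‖)⁻¹ • gradient F q)
      ((‖gradient F q'‖)⁻¹ • gradient F q') ≤ ε / (1 - ε) := by
  subst hS hM
  have hGq := hgrad q hq
  have hGq' := hgrad q' hq'
  have hF2 : ContDiff ℝ 2 F := contDiff_infty.1 hF 2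
  have h1 : 0 < 1 - ε := by linarith
  have ha0 : 0 < ε / (1 - ε) := div_pos hε0 h1
  have hfq : 0 ≤ f q := by
    rw [hf]
    exact infDist_nonneg
  rcases hfq.eq_or_lt with hzero | hpos
  · rw [← hzero, mul_zero] at hd
    obtain rfl : q = q' := dist_le_zero.1 hd
    rw [InnerProductGeometry.angle_self (smul_ne_zero (inv_ne_zero (norm_ne_zero_iff.2 hGq)) hGq)]
    exact ha0.le
  have hfq' : (1 - ε) * f q ≤ f q' := by
    have : f q ≤ f q' + dist q q' := by
      rw [hf, hf]
      exact infDist_le_infDist_add_dist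
    linarith
  have hpos' : 0 < f q' := (mul_pos h1 hpos).trans_le hfq'
  obtain ⟨⟨hF₁, hr₁⟩, hF₂, hr₂⟩ :=
    tangent_balls_of_gradient_ne_zero hF2 hScomp hq hGq (hf q) hpos
  obtain ⟨⟨hF₃, hr₃⟩, hF₄, hr₄⟩ :=
    tangent_balls_of_gradient_ne_zero hF2 hScomp hq' hGq' (hf q') hpos'
  have hu : ‖‖gradient F q‖⁻¹ • gradient F q‖ = 1 := norm_smul_inv_norm hGq
  have hv : ‖‖gradient F q'‖⁻¹ • gradient F q'‖ = 1 := norm_smul_inv_norm hGq'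
  set u := ‖gradient F q‖⁻¹ • gradient F q
  set v := ‖gradient F q'‖⁻¹ • gradient F q'
  have hcross₁ := infDist_add_infDist_le_dist hF.continuous hF₁ hF₄
  have hcross₂ := infDist_add_infDist_le_dist hF.continuous hF₃ hF₂
  have hmain := mul_one_sub_inner_le hu hv hpos.le hpos'.le
    (by linarith : f q + f q' ≤ _) (by linarith : f q + f q' ≤ _)
  have hinner : inner ℝ u v ≤ 1 := by
    have := real_inner_le_norm u v
    rwa [hu, hv, one_mul] at this
  have hcos : 1 - ε ^ 2 / (2 * (1 - ε)) ≤ inner ℝ u v := by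
    have hsq : dist q q' ^ 2 ≤ (ε * f q) ^ 2 := pow_le_pow_left₀ dist_nonneg hd 2
    have hrad : f q * ((1 - ε) * f q) ≤ f q * f q' := mul_le_mul_of_nonneg_left hfq' hpos.le
    have hscaled : f q ^ 2 * ((1 - inner ℝ u v) * (2 * (1 - ε))) ≤ f q ^ 2 * ε ^ 2 := by
      nlinarith [mul_le_mul_of_nonneg_right hrad (sub_nonneg.2 hinner)]
    have := (le_div_iff₀ (by positivity)).2 (le_of_mul_le_mul_left hscaled (by positivity))
    linarith
  have hpi : ε / (1 - ε) ≤ Real.pi := by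
    refine le_trans ?_ Real.pi_gt_three.le
    rw [div_le_iff₀ h1]
    linarith
  rw [InnerProductGeometry.angle, hu, hv, mul_one, div_one, ← Real.arccos_cos ha0.le hpi]
  exact Real.arccos_le_arccos ((cos_div_one_sub_le hε0 hε).trans hcos)
end

section
/- Let Σ = F⁻¹({0}) be the zero level set of a smooth function F : ℝ³ → ℝ whose gradient is nonvanishing on Σ, let M be the medial axis of Σ and f the local feature size. If q and q' are two points of Σ with dist(q,q') ≤ ε·min(f(q), f(q')) for some ε with 0 < ε < 1/3, then the angle between the unit normals satisfies ∠(n_q, n_{q'}) ≤ ε/(1-3ε). -/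
open Metric Set

open scoped Topology InnerProductSpace

section DistanceFunction

variable {E : Type*} [NormedAddCommGroup E] [InnerProductSpace ℝ E]

/-- At a point with a unique nearest point `p` in a compact set, the distance to the set grows
at any rate less than one when moving away from `p`. -/
theorem eventually_infDist_add_le_of_unique_nearest {S : Set E} (hS : IsCompact S) {x p : E}
    (hp : p ∈ S) (hxp : dist x p = infDist x S) (hpos : 0 < infDist x S)
    (huniq : ∀ y ∈ S, dist x y = infDist x S → y = p) {κ : ℝ} (hκ : κ < 1) :
    ∀ᶠ h : ℝ in 𝓝[>] 0,
      infDist x S + κ * h ≤ infDist (x + h • (‖x - p‖⁻¹ • (x - p))) S := by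
  have hne : S.Nonempty := ⟨p, hp⟩
  have hxp' : 0 < ‖x - p‖ := by rw [← dist_eq_norm, hxp]; exact hpos
  set u := ‖x - p‖⁻¹ • (x - p) with hu
  have hun : ‖u‖ = 1 := by
    rw [hu, norm_smul, norm_inv, norm_norm, inv_mul_cancel₀ hxp'.ne']
  have hcont : ContinuousAt (fun y => ⟪u, x - y⟫_ℝ / ‖x - y‖) p := by
    refine ContinuousAt.div ?_ ?_ hxp'.ne' <;> fun_prop
  have hval : ⟪u, x - p⟫_ℝ / ‖x - p‖ = 1 := by
    rw [hu, real_inner_smul_left, real_inner_self_eq_norm_sq]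
    field_simp
  have hev : ∀ᶠ y in 𝓝 p, κ < ⟪u, x - y⟫_ℝ / ‖x - y‖ :=
    hcont.eventually (lt_mem_nhds (hκ.trans_eq hval.symm))
  obtain ⟨V, hV, hVo, hpV⟩ := _root_.eventually_nhds_iff.1 hev
  obtain ⟨η, hη, hfar⟩ : ∃ η > 0, ∀ y ∈ S \ V, infDist x S + 2 * η ≤ dist x y := by
    rcases (S \ V).eq_empty_or_nonempty with he | hn
    · exact ⟨1, one_pos, by simp [he]⟩
    · obtain ⟨z, hz, hmin⟩ := (hS.diff hVo).exists_isMinOn hn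
        (f := fun y => dist x y) (by fun_prop)
      have hlt : infDist x S < dist x z := by
        refine lt_of_le_of_ne (infDist_le_dist_of_mem hz.1) fun h => hz.2 ?_
        rw [huniq z hz.1 h.symm]
        exact hpV
      refine ⟨(dist x z - infDist x S) / 2, by linarith, fun y hy => ?_⟩
      have := isMinOn_iff.1 hmin y hy
      linarith
  filter_upwards [Ioo_mem_nhdsGT hη] with h hh
  refine (le_infDist hne).2 fun y hy => ?_
  have hxy : 0 < ‖x - y‖ := by
    rw [← dist_eq_norm]; exact hpos.trans_le (infDist_le_dist_of_mem hy)
  by_cases hyV : y ∈ V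
  · have h1 := hV y hyV
    have h2 : ⟪x + h • u - y, x - y⟫_ℝ ≤ ‖x + h • u - y‖ * ‖x - y‖ := real_inner_le_norm _ _
    have h3 : ⟪x + h • u - y, x - y⟫_ℝ = ‖x - y‖ ^ 2 + h * ⟪u, x - y⟫_ℝ := by
      rw [show x + h • u - y = (x - y) + h • u by abel, inner_add_left, real_inner_smul_left,
        real_inner_self_eq_norm_sq]
    rw [lt_div_iff₀ hxy] at h1
    have h4 : h * (κ * ‖x - y‖) ≤ h * ⟪u, x - y⟫_ℝ := mul_le_mul_of_nonneg_left h1.le hh.1.le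
    have h5 : ‖x - y‖ + κ * h ≤ ‖x + h • u - y‖ := by
      refine le_of_mul_le_mul_right ?_ hxy
      nlinarith
    have h6 := infDist_le_dist_of_mem (x := x) hy
    rw [dist_eq_norm] at h6 ⊢
    linarith
  · have h1 := hfar y ⟨hy, hyV⟩
    have h2 := dist_triangle x (x + h • u) y
    have h3 : dist x (x + h • u) = h := by
      rw [dist_self_add_right, norm_smul, hun, Real.norm_of_nonneg hh.1.le, mul_one]
    have h4 : κ * h ≤ h := by nlinarith [hh.1]
    linarith [hh.2]

/-- If every point of `closedBall c s` has a unique nearest point in `S`, then some point of that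
ball is farther from `S` than `c` by the full amount `s`. -/
theorem exists_infDist_add_le [ProperSpace E] {S : Set E} (hS : IsCompact S) (hne : S.Nonempty)
    {c : E} {s : ℝ} (hs : 0 < s) (hsc : s < infDist c S)
    (huniq : ∀ x ∈ closedBall c s, ∀ y ∈ S, ∀ z ∈ S,
      dist x y = infDist x S → dist x z = infDist x S → y = z) :
    ∃ x ∈ closedBall c s, infDist c S + s ≤ infDist x S := by
  have hK : IsCompact (closedBall c s) := isCompact_closedBall c s
  have hKne : (closedBall c s).Nonempty := ⟨c, mem_closedBall_self hs.le⟩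
  have key : ∀ κ : ℝ, 0 < κ → κ < 1 → ∃ x ∈ closedBall c s,
      infDist c S + κ * s ≤ infDist x S := by
    intro κ hκ0 hκ
    obtain ⟨x, hx, hmax⟩ := hK.exists_isMaxOn hKne
      (f := fun x => infDist x S - κ * dist x c)
      ((continuous_infDist_pt S).sub (by fun_prop)).continuousOn
    rw [isMaxOn_iff] at hmax
    refine ⟨x, hx, ?_⟩
    rcases (mem_closedBall.1 hx).lt_or_eq with hlt | heq
    · exfalso
      obtain ⟨p, hp, hxp⟩ := hS.exists_infDist_eq_dist hne x
      have hpos : 0 < infDist x S := by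
        have := infDist_le_infDist_add_dist (s := S) (x := c) (y := x)
        rw [dist_comm] at this
        linarith
      have hev := eventually_infDist_add_le_of_unique_nearest hS hp hxp.symm hpos
        (fun y hy h => huniq x hx y hy p hp h hxp.symm) (κ := (κ + 1) / 2) (by linarith)
      obtain ⟨h, h1, h2⟩ := (hev.and (Ioo_mem_nhdsGT (sub_pos.2 hlt))).exists
      set u := ‖x - p‖⁻¹ • (x - p) with hu
      have hun : ‖u‖ = 1 := by
        have : 0 < ‖x - p‖ := by rw [← dist_eq_norm, ← hxp]; exact hpos
        rw [hu, norm_smul, norm_inv, norm_norm, inv_mul_cancel₀ this.ne']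
      have h3 : dist (x + h • u) c ≤ h + dist x c := by
        refine (dist_triangle _ x _).trans ?_
        rw [dist_self_add_left, norm_smul, hun, Real.norm_of_nonneg h2.1.le, mul_one]
      have h4 := hmax (x + h • u) (mem_closedBall.2 (by linarith [h2.2]))
      have h5 : κ * dist (x + h • u) c ≤ κ * (h + dist x c) :=
        mul_le_mul_of_nonneg_left h3 hκ0.le
      nlinarith [h2.1]
    · have h1 := hmax c (mem_closedBall_self hs.le)
      rw [heq, dist_self] at h1
      linarith
  obtain ⟨x, hx, hmax⟩ := hK.exists_isMaxOn hKne (continuous_infDist_pt S).continuousOn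
  rw [isMaxOn_iff] at hmax
  refine ⟨x, hx, ?_⟩
  by_contra! hlt
  have hcx := hmax c (mem_closedBall_self hs.le)
  obtain ⟨κ, hκ1, hκ2⟩ := exists_between
    (show (infDist x S - infDist c S) / s < 1 by rw [div_lt_one hs]; linarith)
  obtain ⟨y, hy, hle⟩ := key κ ((div_nonneg (sub_nonneg.2 hcx) hs.le).trans_lt hκ1) hκ2
  have := hmax y hy
  rw [div_lt_iff₀ hs] at hκ1
  linarith

/-- The points with more than one nearest point in `S`. -/
def multipleNearest (S : Set E) : Set E :=
  {x | ∃ y ∈ S, ∃ z ∈ S, y ≠ z ∧ dist x y = infDist x S ∧ dist x z = infDist x S}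

/-- A ball touching `S` from outside at `q` can be enlarged as long as its centre avoids the
closure of the set of points with several nearest points. -/
theorem exists_forall_infDist_add_smul_eq [ProperSpace E] {S : Set E} (hS : IsCompact S)
    {q n : E} (hq : q ∈ S) (hn : ‖n‖ = 1) {t : ℝ} (ht : 0 < t)
    (htS : infDist (q + t • n) S = t) (hM : q + t • n ∉ closure (multipleNearest S)) :
    ∃ δ > 0, ∀ s, 0 < s → s < δ → infDist (q + (t + s) • n) S = t + s := by
  obtain ⟨δ, hδ, hball⟩ := Metric.isOpen_iff.1 isClosed_closure.isOpen_compl _ hM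
  refine ⟨min δ t, lt_min hδ ht, fun s hs hsδ => ?_⟩
  obtain ⟨x, hx, hle⟩ := exists_infDist_add_le hS ⟨q, hq⟩ (c := q + t • n) hs
    (by rw [htS]; exact hsδ.trans_le (min_le_right _ _)) (by
      intro x hx y hy z hz hxy hxz
      by_contra hyz
      exact hball (closedBall_subset_ball (hsδ.trans_le (min_le_left _ _)) hx)
        (subset_closure ⟨y, hy, z, hz, hyz, hxy, hxz⟩))
  rw [htS] at hle
  set v := x - (q + t • n) with hv
  have hvs : ‖v‖ ≤ s := by rw [hv, ← dist_eq_norm]; exact hx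
  have hvt : t + s ≤ ‖v + t • n‖ := by
    have := hle.trans (infDist_le_dist_of_mem hq)
    rwa [dist_eq_norm, show x - q = v + t • n by rw [hv]; abel] at this
  have h1 : ‖v + t • n‖ ^ 2 = ‖v‖ ^ 2 + 2 * (t * ⟪v, n⟫_ℝ) + t ^ 2 := by
    rw [norm_add_sq_real, real_inner_smul_right, norm_smul, hn, Real.norm_of_nonneg ht.le, mul_one]
  have h2 : ‖v - s • n‖ ^ 2 = ‖v‖ ^ 2 - 2 * (s * ⟪v, n⟫_ℝ) + s ^ 2 := by
    rw [norm_sub_sq_real, real_inner_smul_right, norm_smul, hn, Real.norm_of_nonneg hs.le, mul_one]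
  have h3 : (t + s) ^ 2 ≤ ‖v + t • n‖ ^ 2 := pow_le_pow_left₀ (by positivity) hvt 2
  have h4 : ‖v‖ ^ 2 ≤ s ^ 2 := pow_le_pow_left₀ (norm_nonneg _) hvs 2
  have h5 : s ≤ ⟪v, n⟫_ℝ := by
    refine le_of_mul_le_mul_left ?_ ht
    nlinarith
  have h6 : ‖v - s • n‖ ^ 2 ≤ 0 := by nlinarith
  have h7 : v - s • n = 0 := norm_eq_zero.1 (pow_eq_zero_iff two_ne_zero |>.1
    (le_antisymm h6 (sq_nonneg _)))
  have h8 : x = q + (t + s) • n := by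
    have : x = q + t • n + v := by rw [hv]; abel
    rw [this, sub_eq_zero.1 h7, add_smul, add_assoc]
  rw [← h8]
  refine le_antisymm ?_ hle
  refine (infDist_le_dist_of_mem hq).trans ?_
  rw [h8, dist_self_add_left, norm_smul, hn, Real.norm_of_nonneg (by positivity), mul_one]

/-- A small ball touching `S` at `q` can be enlarged until its radius is the distance from `q` to
the medial axis. -/
theorem infDist_add_smul_eq_of_le_infDist [ProperSpace E] {S : Set E} (hS : IsCompact S)
    {q n : E} (hq : q ∈ S) (hn : ‖n‖ = 1) {t r : ℝ} (ht : 0 < t) (htr : t ≤ r)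
    (htS : infDist (q + t • n) S = t) (hr : r ≤ infDist q (closure (multipleNearest S))) :
    infDist (q + r • n) S = r := by
  have hclosed : IsClosed ({a : ℝ | infDist (q + a • n) S = a} ∩ Icc t r) := by
    refine IsClosed.inter (isClosed_eq ?_ continuous_id) isClosed_Icc
    exact (continuous_infDist_pt S).comp (by fun_prop)
  refine hclosed.Icc_subset_of_forall_exists_gt htS ?_ (right_mem_Icc.2 htr)
  rintro a ⟨ha, hat, har⟩ y (hy : a < y)
  have ha0 : 0 < a := ht.trans_le hat
  obtain ⟨δ, hδ, hext⟩ := exists_forall_infDist_add_smul_eq hS hq hn ha0 ha fun hmem => by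
    have := infDist_le_dist_of_mem (x := q) hmem
    rw [dist_self_add_right, norm_smul, hn, Real.norm_of_nonneg ha0.le, mul_one] at this
    linarith
  have hmin : 0 < min δ (y - a) := lt_min hδ (sub_pos.2 hy)
  have h1 := min_le_left δ (y - a)
  have h2 := min_le_right δ (y - a)
  exact ⟨a + min δ (y - a) / 2, hext _ (by linarith) (by linarith), by linarith, by linarith⟩

end DistanceFunction

section LevelSet

variable {E : Type*} [NormedAddCommGroup E] [InnerProductSpace ℝ E] [CompleteSpace E]

theorem inner_gradient_eq_fderiv (F : E → ℝ) (x v : E) :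
    ⟪gradient F x, v⟫_ℝ = fderiv ℝ F x v := by
  rw [gradient, InnerProductSpace.toDual_symm_apply]

theorem gradient_neg_apply (F : E → ℝ) (x : E) :
    gradient (fun y => -F y) x = -gradient F x := by
  simp [gradient, fderiv_fun_neg]

/-- A regular level set has an exterior tangent ball at each of its points. -/
theorem exists_infDist_add_smul_gradient_eq {F : E → ℝ} (hF : ContDiff ℝ 2 F) {q : E}
    (hq : F q = 0) (hg : gradient F q ≠ 0) {r : ℝ} (hr : 0 < r) :
    ∃ t, 0 < t ∧ t ≤ r ∧
      infDist (q + t • (‖gradient F q‖⁻¹ • gradient F q)) (F ⁻¹' {0}) = t := by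
  have hgpos : 0 < ‖gradient F q‖ := norm_pos_iff.2 hg
  set n := ‖gradient F q‖⁻¹ • gradient F q with hn
  have hnn : ‖n‖ = 1 := by rw [hn, norm_smul, norm_inv, norm_norm, inv_mul_cancel₀ hgpos.ne']
  have hF' : ContDiff ℝ 1 (fderiv ℝ F) := hF.fderiv_right (by norm_num)
  obtain ⟨K, U, hU, hK⟩ := hF'.contDiffAt.exists_lipschitzOnWith (x := q)
  obtain ⟨δ, hδ, hδU⟩ := Metric.mem_nhds_iff.1 hU
  have taylor : ∀ y, dist y q < δ → F y = 0 → ⟪gradient F q, y - q⟫_ℝ ≤ K * dist y q ^ 2 := by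
    intro y hy hy0
    have hb : ∀ z ∈ closedBall q (dist y q), ‖fderiv ℝ F z - fderiv ℝ F q‖ ≤ K * dist y q := by
      intro z hz
      rw [← dist_eq_norm]
      refine (hK.dist_le_mul z (hδU ?_) q (mem_of_mem_nhds hU)).trans ?_
      · exact closedBall_subset_ball hy hz
      · exact mul_le_mul_of_nonneg_left hz K.2
    have := (convex_closedBall q (dist y q)).norm_image_sub_le_of_norm_fderiv_le'
      (fun z _ => hF.differentiable (by norm_num) z) hb
      (mem_closedBall_self dist_nonneg) (mem_closedBall.2 le_rfl)
    rw [hy0, hq, sub_zero, zero_sub, norm_neg, ← dist_eq_norm] at this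
    rw [inner_gradient_eq_fderiv]
    linarith [Real.le_norm_self (fderiv ℝ F q (y - q))]
  set t := min (min r (δ / 2)) (‖gradient F q‖ / (2 * (K + 1)))
  have hK0 : (0 : ℝ) ≤ K := K.2
  have ht : 0 < t := by positivity
  have htr : t ≤ r := (min_le_left _ _).trans (min_le_left _ _)
  have htδ : t ≤ δ / 2 := (min_le_left _ _).trans (min_le_right _ _)
  have htK : t * (2 * (K + 1)) ≤ ‖gradient F q‖ := by
    rw [← le_div_iff₀ (by positivity)]; exact min_le_right _ _
  have hqt : dist (q + t • n) q = t := by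
    rw [dist_self_add_left, norm_smul, hnn, Real.norm_of_nonneg ht.le, mul_one]
  refine ⟨t, ht, htr, le_antisymm ?_ ?_⟩
  · exact (infDist_le_dist_of_mem (show q ∈ F ⁻¹' {0} from hq)).trans hqt.le
  · refine (le_infDist ⟨q, hq⟩).2 fun y hy => ?_
    by_contra! hlt
    have hyq : dist y q < δ := by
      have := dist_triangle y (q + t • n) q
      rw [dist_comm y (q + t • n)] at this
      linarith
    have h1 := taylor y hyq hy
    have h2 : ‖(y - q) - t • n‖ ^ 2 < t ^ 2 := by
      rw [dist_comm, dist_eq_norm, show y - (q + t • n) = (y - q) - t • n by abel] at hlt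
      exact pow_lt_pow_left₀ hlt (norm_nonneg _) two_ne_zero
    rw [norm_sub_sq_real, real_inner_smul_right, norm_smul, hnn, Real.norm_of_nonneg ht.le,
      mul_one] at h2
    have h3 : ⟪gradient F q, y - q⟫_ℝ = ‖gradient F q‖ * ⟪y - q, n⟫_ℝ := by
      rw [hn, real_inner_smul_right, real_inner_comm]
      field_simp
    rw [h3, dist_eq_norm] at h1
    have h4 : ‖y - q‖ ^ 2 < 2 * (t * ⟪y - q, n⟫_ℝ) := by linarith
    have h5 : 0 < ⟪y - q, n⟫_ℝ := by
      by_contra! h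
      nlinarith [sq_nonneg ‖y - q‖, mul_nonneg ht.le (neg_nonneg.2 h)]
    have h6 : t * (2 * (K + 1)) * ⟪y - q, n⟫_ℝ ≤ K * ‖y - q‖ ^ 2 :=
      (mul_le_mul_of_nonneg_right htK h5.le).trans h1
    nlinarith [mul_nonneg hK0 (sub_nonneg.2 h4.le), mul_pos ht h5]

/-- The tangent ball on the gradient side of a level set, of radius at most the local feature
size, lies in the positivity set. -/
theorem pos_of_mem_ball_add_smul_gradient [ProperSpace E] {F : E → ℝ} (hF : ContDiff ℝ 2 F)
    (hS : IsCompact (F ⁻¹' {0})) {q : E} (hq : F q = 0) (hg : gradient F q ≠ 0) {r : ℝ}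
    (hr0 : 0 < r) (hr : r ≤ infDist q (closure (multipleNearest (F ⁻¹' {0})))) {x : E}
    (hx : x ∈ ball (q + r • (‖gradient F q‖⁻¹ • gradient F q)) r) : 0 < F x := by
  have hgpos : 0 < ‖gradient F q‖ := norm_pos_iff.2 hg
  obtain ⟨t, ht, htr, htS⟩ := exists_infDist_add_smul_gradient_eq hF hq hg hr0
  set n := ‖gradient F q‖⁻¹ • gradient F q with hn
  have hnn : ‖n‖ = 1 := by rw [hn, norm_smul, norm_inv, norm_norm, inv_mul_cancel₀ hgpos.ne']
  have hrS := infDist_add_smul_eq_of_le_infDist hS hq hnn ht htr htS hr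
  have hne : ∀ y ∈ ball (q + r • n) r, F y ≠ 0 := by
    intro y hy h0
    have := infDist_le_dist_of_mem (x := q + r • n) (show y ∈ F ⁻¹' {0} from h0)
    rw [hrS, dist_comm] at this
    exact absurd (mem_ball.1 hy) this.not_gt
  obtain ⟨y, hy, hy0⟩ : ∃ y ∈ ball (q + r • n) r, 0 < F y := by
    have hd : HasDerivAt (fun s : ℝ => F (q + s • n)) ‖gradient F q‖ 0 := by
      have hl : HasDerivAt (fun s : ℝ => q + s • n) n 0 := by
        simpa using ((hasDerivAt_id (0 : ℝ)).smul_const n).const_add q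
      have hFd : HasFDerivAt F (fderiv ℝ F q) (q + (0 : ℝ) • n) := by
        simpa using (hF.differentiable (by norm_num) q).hasFDerivAt
      have := hFd.comp_hasDerivAt (0 : ℝ) hl
      rw [← inner_gradient_eq_fderiv, hn, real_inner_smul_right, real_inner_self_eq_norm_sq,
        show ‖gradient F q‖⁻¹ * ‖gradient F q‖ ^ 2 = ‖gradient F q‖ by field_simp] at this
      exact this
    have hslope := (hasDerivAt_iff_tendsto_slope.1 hd).mono_left
      (nhdsWithin_mono (0 : ℝ) (t := {0}ᶜ) (s := Ioi 0) fun s hs => ne_of_gt hs)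
    obtain ⟨s, hs1, hs2⟩ :=
      ((hslope.eventually (lt_mem_nhds hgpos)).and (Ioo_mem_nhdsGT hr0)).exists
    refine ⟨q + s • n, ?_, ?_⟩
    · rw [mem_ball, dist_add_left, dist_eq_norm, ← sub_smul, norm_smul, hnn, mul_one,
        Real.norm_eq_abs, abs_lt]
      constructor <;> linarith [hs2.1, hs2.2]
    · rw [slope_def_field] at hs1
      have := (div_pos_iff_of_pos_right (by simpa using hs2.1)).1 hs1
      simpa [hq] using this
  by_contra! hx0
  obtain ⟨z, hz, hz0⟩ := (convex_ball (q + r • n) r).isPreconnected.intermediate_value hx hy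
    hF.continuous.continuousOn ⟨hx0, hy0.le⟩
  exact hne z hz hz0

/-- The unit normals of a compact regular level set are Lipschitz, with the inverse of the local
feature size as constant. -/
theorem mul_norm_sub_unit_gradient_le_dist [ProperSpace E] {F : E → ℝ} (hF : ContDiff ℝ 2 F)
    (hS : IsCompact (F ⁻¹' {0})) {q q' : E} (hq : F q = 0) (hq' : F q' = 0)
    (hg : gradient F q ≠ 0) (hg' : gradient F q' ≠ 0) {r : ℝ} (hr0 : 0 < r)
    (hr : r ≤ infDist q (closure (multipleNearest (F ⁻¹' {0}))))
    (hr' : r ≤ infDist q' (closure (multipleNearest (F ⁻¹' {0})))) :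
    r * ‖‖gradient F q‖⁻¹ • gradient F q - ‖gradient F q'‖⁻¹ • gradient F q'‖ ≤ dist q q' := by
  have hneg : (fun x => -F x) ⁻¹' {0} = F ⁻¹' {0} := by ext; simp
  have neg_of_mem : ∀ {p x : E}, F p = 0 → gradient F p ≠ 0 →
      r ≤ infDist p (closure (multipleNearest (F ⁻¹' {0}))) →
      x ∈ ball (p - r • (‖gradient F p‖⁻¹ • gradient F p)) r → F x < 0 := by
    intro p x hp hgp hrp hx
    have := pos_of_mem_ball_add_smul_gradient (F := fun x => -F x) (q := p) (x := x) hF.neg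
      (by rwa [hneg]) (by simpa using hp) (by rwa [gradient_neg_apply, neg_ne_zero]) hr0
      (by rwa [hneg]) (by
        rw [gradient_neg_apply, norm_neg, smul_neg, smul_neg, ← sub_eq_add_neg]
        exact hx)
    linarith
  have disj : ∀ {a b : E}, (∀ x ∈ ball a r, 0 < F x) → (∀ x ∈ ball b r, F x < 0) →
      2 * r ≤ ‖a - b‖ := by
    intro a b ha hb
    by_contra! hlt
    have h1 := ha (midpoint ℝ a b) (by
      rw [mem_ball, dist_midpoint_left, dist_eq_norm, Real.norm_ofNat]; linarith)
    have h2 := hb (midpoint ℝ a b) (by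
      rw [mem_ball, dist_midpoint_right, dist_eq_norm, Real.norm_ofNat]; linarith)
    exact h1.not_gt h2
  have e1 := disj (fun x hx => pos_of_mem_ball_add_smul_gradient hF hS hq hg hr0 hr hx)
    (fun x hx => neg_of_mem hq' hg' hr' hx)
  have e2 := disj (fun x hx => pos_of_mem_ball_add_smul_gradient hF hS hq' hg' hr0 hr' hx)
    (fun x hx => neg_of_mem hq hg hr hx)
  have hnn : ‖‖gradient F q‖⁻¹ • gradient F q‖ = 1 := by
    rw [norm_smul, norm_inv, norm_norm, inv_mul_cancel₀ (norm_ne_zero_iff.2 hg)]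
  have hnn' : ‖‖gradient F q'‖⁻¹ • gradient F q'‖ = 1 := by
    rw [norm_smul, norm_inv, norm_norm, inv_mul_cancel₀ (norm_ne_zero_iff.2 hg')]
  set n := ‖gradient F q‖⁻¹ • gradient F q
  set n' := ‖gradient F q'‖⁻¹ • gradient F q'
  rw [show q + r • n - (q' - r • n') = r • (n + n') + (q - q') by rw [smul_add]; abel] at e1
  rw [show q' + r • n' - (q - r • n) = r • (n + n') - (q - q') by rw [smul_add]; abel] at e2
  have s1 := pow_le_pow_left₀ (by positivity) e1 2
  have s2 := pow_le_pow_left₀ (by positivity) e2 2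
  have p1 := parallelogram_law_with_norm ℝ (r • (n + n')) (q - q')
  have p2 := parallelogram_law_with_norm ℝ n n'
  rw [norm_smul, Real.norm_of_nonneg hr0.le] at p1
  rw [hnn, hnn'] at p2
  rw [dist_eq_norm]
  refine le_of_sq_le_sq ?_ (norm_nonneg _)
  nlinarith

end LevelSet

/-- Unit vectors at distance at most `ε < 1/3` make an angle at most `ε / (1 - 3 * ε)`. -/
theorem angle_le_div_of_norm_sub_le {E : Type*} [NormedAddCommGroup E] [InnerProductSpace ℝ E]
    {n n' : E} (hn : ‖n‖ = 1) (hn' : ‖n'‖ = 1) {ε : ℝ} (hε0 : 0 < ε) (hε : ε < 1 / 3)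
    (h : ‖n - n'‖ ≤ ε) : InnerProductGeometry.angle n n' ≤ ε / (1 - 3 * ε) := by
  have hden : 0 < 1 - 3 * ε := by linarith
  set T := ε / (1 - 3 * ε) with hT
  have hT0 : 0 < T := div_pos hε0 hden
  rcases le_total Real.pi T with hπ | hπ
  · exact (InnerProductGeometry.angle_le_pi _ _).trans hπ
  have hinner : 1 - ε ^ 2 / 2 ≤ ⟪n, n'⟫_ℝ := by
    have h1 := norm_sub_sq_real n n'
    rw [hn, hn'] at h1
    nlinarith [pow_le_pow_left₀ (norm_nonneg _) h 2]
  have hcos : Real.cos T ≤ 1 - ε ^ 2 / 2 := by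
    refine (Real.cos_le_one_div_sqrt_sq_add_one (by linarith [Real.pi_pos])
      (by linarith [Real.pi_pos])).trans ?_
    have hTε : T * (1 - 3 * ε) = ε := div_mul_cancel₀ _ hden.ne'
    have hT2 : ε ^ 2 ≤ T ^ 2 * (1 - ε ^ 2) := by
      have : ε ^ 2 = T ^ 2 * (1 - 3 * ε) ^ 2 := by rw [← mul_pow, hTε]
      rw [this]
      refine mul_le_mul_of_nonneg_left ?_ (sq_nonneg T)
      nlinarith
    rw [div_le_iff₀ (by positivity)]
    have hε2 : 0 ≤ 1 - ε ^ 2 / 2 := by nlinarith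
    rw [← Real.sqrt_sq hε2, ← Real.sqrt_mul (sq_nonneg _), Real.one_le_sqrt]
    nlinarith [mul_nonneg (sq_nonneg (ε ^ 2)) (add_nonneg (sq_nonneg T) zero_le_one)]
  rw [InnerProductGeometry.angle, hn, hn', mul_one, div_one, ← Real.arccos_cos hT0.le hπ]
  exact Real.arccos_le_arccos (hcos.trans hinner)

/-- Normal variation theorem: if `q, q' ∈ Σ` with `dist q q' ≤ ε · min (f q) (f q')`,
`0 < ε < 1/3`, then the angle between the unit normals is at most `ε/(1-3ε)`. -/
theorem normal_variation_amenta_bern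
    (F : EuclideanSpace ℝ (Fin 3) → ℝ) (hF : ContDiff ℝ (⊤ : ℕ∞) F)
    (S : Set (EuclideanSpace ℝ (Fin 3))) (hS : S = F ⁻¹' {0})
    (hScomp : IsCompact S)
    (hgrad : ∀ p ∈ S, gradient F p ≠ 0)
    (M : Set (EuclideanSpace ℝ (Fin 3))) (hM : M = medialAxis S)
    (hMne : M.Nonempty)
    (f : EuclideanSpace ℝ (Fin 3) → ℝ) (hf : ∀ x, f x = Metric.infDist x M)
    (q q' : EuclideanSpace ℝ (Fin 3)) (hq : q ∈ S) (hq' : q' ∈ S)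
    (ε : ℝ) (hε0 : 0 < ε) (hε : ε < 1/3)
    (hd : dist q q' ≤ ε * min (f q) (f q')) :
    InnerProductGeometry.angle
      ((‖gradient F q‖)⁻¹ • gradient F q)
      ((‖gradient F q'‖)⁻¹ • gradient F q') ≤ ε / (1 - 3 * ε) := by
  subst hS
  have hg := hgrad q hq
  have hg' := hgrad q' hq'
  have hMeq : M = closure (multipleNearest (F ⁻¹' {0})) := hM
  have hfM : ∀ x, f x = infDist x (closure (multipleNearest (F ⁻¹' {0}))) := by
    intro x; rw [hf, hMeq]
  have unit : ∀ {g : EuclideanSpace ℝ (Fin 3)}, g ≠ 0 → ‖‖g‖⁻¹ • g‖ = 1 := fun h => by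
    rw [norm_smul, norm_inv, norm_norm, inv_mul_cancel₀ (norm_ne_zero_iff.2 h)]
  refine angle_le_div_of_norm_sub_le (unit hg) (unit hg') hε0 hε ?_
  have hr : 0 ≤ min (f q) (f q') :=
    le_min (by rw [hf]; exact infDist_nonneg) (by rw [hf]; exact infDist_nonneg)
  rcases hr.eq_or_lt with h0 | hpos
  · rw [← h0, mul_zero] at hd
    rw [dist_le_zero.1 hd, sub_self, norm_zero]
    exact hε0.le
  · have := mul_norm_sub_unit_gradient_le_dist (contDiff_infty.1 hF 2) hScomp
      hq hq' hg hg' hpos ((min_le_left _ _).trans (hfM q).le) ((min_le_right _ _).trans (hfM q').le)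
    refine le_of_mul_le_mul_left ?_ hpos
    linarith
end

section
/- Let Σ = F⁻¹({0}) be the zero level set of a smooth function F : ℝ³ → ℝ whose gradient is nonvanishing on Σ, let M be the medial axis of Σ and f the local feature size. If q and q' are two points of Σ with dist(q,q') ≤ ε·f(q) for some ε with 0 < ε ≤ 1/3, then the angle between the unit normals satisfies ∠(n_q, n_{q'}) ≤ dist(q,q') / ((1-ε)·f(q)). -/
open Metric Set

open Filter Topology InnerProductGeometry

section InnerProduct

variable {V : Type*} [NormedAddCommGroup V] [InnerProductSpace ℝ V]

/-- If `b` lies in every closed half-space whose open half-space contains `a`, then `a` and `b`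
point in the same direction. -/
theorem norm_smul_eq_norm_smul_of_forall_inner {a b : V}
    (h : ∀ v : V, 0 < inner ℝ v a → 0 ≤ inner ℝ v b) : ‖b‖ • a = ‖a‖ • b := by
  by_contra hne
  have hlt : inner ℝ a b < ‖a‖ * ‖b‖ :=
    lt_of_le_of_ne (real_inner_le_norm a b) (mt inner_eq_norm_mul_iff_real.mp hne)
  have ha : 0 < ‖a‖ := by
    rw [norm_pos_iff]
    rintro rfl
    simp at hne
  have hb : 0 < ‖b‖ := by
    rw [norm_pos_iff]
    rintro rfl
    simp at hne
  have h1 : inner ℝ (‖b‖ • a - ‖a‖ • b) a = ‖a‖ * (‖a‖ * ‖b‖ - inner ℝ a b) := by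
    rw [inner_sub_left, real_inner_smul_left, real_inner_smul_left, real_inner_self_eq_norm_sq,
      real_inner_comm a b]
    ring
  have h2 : inner ℝ (‖b‖ • a - ‖a‖ • b) b = -(‖b‖ * (‖a‖ * ‖b‖ - inner ℝ a b)) := by
    rw [inner_sub_left, real_inner_smul_left, real_inner_smul_left, real_inner_self_eq_norm_sq]
    ring
  have h3 := h (‖b‖ • a - ‖a‖ • b) (h1 ▸ mul_pos ha (sub_pos.mpr hlt))
  rw [h2] at h3
  linarith [mul_pos hb (sub_pos.mpr hlt)]

theorem eventually_norm_sub_smul_lt {v w : V} (h : 0 < inner ℝ v w) :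
    ∀ᶠ s in 𝓝[>] (0 : ℝ), ‖w - s • v‖ < ‖w‖ := by
  have hlim : Tendsto (fun s : ℝ => 2 * inner ℝ v w - s * ‖v‖ ^ 2) (𝓝[>] 0)
      (𝓝 (2 * inner ℝ v w - 0 * ‖v‖ ^ 2)) :=
    Tendsto.mono_left (Continuous.tendsto (by fun_prop) 0) nhdsWithin_le_nhds
  filter_upwards [hlim.eventually_const_lt (by linarith : (0 : ℝ) < _), self_mem_nhdsWithin]
    with s hs hs0
  have hs0 : 0 < s := hs0
  refine lt_of_pow_lt_pow_left₀ 2 (norm_nonneg _) ?_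
  rw [norm_sub_sq_real, real_inner_smul_right, norm_smul, Real.norm_of_nonneg hs0.le,
    real_inner_comm]
  nlinarith [mul_pos hs0 hs]

theorem norm_sub_mul_le_of_le_norm_add {z N N' : V} {a s : ℝ} (hs : 0 ≤ s)
    (hN : ‖N‖ = 1) (hN' : ‖N'‖ = 1) (ha : |a| ≤ 2 * s)
    (h1 : 2 * s + a ≤ ‖z + s • (N + N')‖) (h2 : 2 * s - a ≤ ‖-z + s • (N + N')‖) :
    ‖N - N'‖ * s ≤ ‖z‖ := by
  obtain ⟨ha1, ha2⟩ := abs_le.mp ha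
  have e1 : (2 * s + a) ^ 2 ≤ ‖z + s • (N + N')‖ ^ 2 := pow_le_pow_left₀ (by linarith) h1 2
  have e2 : (2 * s - a) ^ 2 ≤ ‖-z + s • (N + N')‖ ^ 2 := pow_le_pow_left₀ (by linarith) h2 2
  rw [norm_add_sq_real, norm_smul, Real.norm_of_nonneg hs] at e1 e2
  rw [inner_neg_left, norm_neg] at e2
  have e3 : ‖N + N'‖ ^ 2 + ‖N - N'‖ ^ 2 = 4 := by
    rw [norm_add_sq_real, norm_sub_sq_real, hN, hN']
    ring
  refine le_of_sq_le_sq ?_ (norm_nonneg z)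
  nlinarith [sq_nonneg a]

theorem angle_le_add_cube_of_norm_sub_le {x y : V} (hx : ‖x‖ = 1) (hy : ‖y‖ = 1) {c : ℝ}
    (h : ‖x - y‖ ≤ c) : angle x y ≤ c + c ^ 3 := by
  have hc : 0 ≤ c := (norm_nonneg _).trans h
  set θ := angle x y with hθ
  have hθ0 : 0 ≤ θ := angle_nonneg x y
  have hθπ : θ ≤ Real.pi := angle_le_pi x y
  have hcos : Real.cos θ = 1 - ‖x - y‖ ^ 2 / 2 := by
    have := norm_sub_sq_real x y
    rw [hx, hy] at this
    rw [hθ, cos_angle, hx, hy]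
    linarith
  have hsin : 2 * Real.sin (θ / 2) ≤ c := by
    refine le_trans (le_of_sq_le_sq ?_ (norm_nonneg (x - y))) h
    have h1 := Real.cos_sq_add_sin_sq (θ / 2)
    have h2 := Real.cos_two_mul (θ / 2)
    rw [mul_div_cancel₀ θ two_ne_zero] at h2
    nlinarith
  have hjordan := Real.mul_le_sin (x := θ / 2) (by linarith) (by linarith)
  have hθ2 : θ ≤ 2 * c := by
    have h1 : 2 / Real.pi * (θ / 2) ≤ c / 2 := by linarith
    rw [div_mul_eq_mul_div, div_le_iff₀ Real.pi_pos] at h1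
    nlinarith [Real.pi_le_four]
  have hcube : θ ^ 3 ≤ (2 * c) ^ 3 := pow_le_pow_left₀ hθ0 hθ2 3
  have hlow : θ / 2 - (θ / 2) ^ 3 / 6 ≤ Real.sin (θ / 2) := by
    rcases hθ0.eq_or_lt with h0 | h0
    · simp [← h0]
    · exact (Real.sin_gt_sub_cube (by linarith)).le
  nlinarith [pow_nonneg hc 3]

/-- A chain of unit vectors with consecutive chords of length at most `c` turns by at most the
sum of the corresponding angle bounds. -/
theorem angle_chain_le {N : ℕ → V} {n : ℕ} {c : ℝ} (hN : ∀ i ≤ n, ‖N i‖ = 1)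
    (h : ∀ i < n, ‖N i - N (i + 1)‖ ≤ c) : angle (N 0) (N n) ≤ n * (c + c ^ 3) := by
  have key : ∀ i ≤ n, angle (N 0) (N i) ≤ i * (c + c ^ 3) := by
    intro i
    induction i with
    | zero =>
      intro h0
      rw [angle_self (norm_ne_zero_iff.mp (by rw [hN 0 h0]; exact one_ne_zero))]
      simp
    | succ i ih =>
      intro hi
      have h1 := angle_le_angle_add_angle (N 0) (N i) (N (i + 1))
      have h2 := angle_le_add_cube_of_norm_sub_le (hN i (by omega)) (hN (i + 1) hi)
        (h i (by omega))
      have h3 := ih (by omega)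
      push_cast
      linarith
  exact key n le_rfl

end InnerProduct

section SignedDistance

theorem neg_preimage_zero {V : Type*} (F : V → ℝ) : (fun z => -F z) ⁻¹' {0} = F ⁻¹' {0} := by
  ext z
  simp

variable {V : Type*} [NormedAddCommGroup V]

/-- The signed distance to the zero set of `F`, positive where `F` is. -/
noncomputable def zeroSetSignedDist (F : V → ℝ) (x : V) : ℝ :=
  if 0 < F x then infDist x (F ⁻¹' {0}) else -infDist x (F ⁻¹' {0})

variable {F : V → ℝ} {x y : V}

theorem zeroSetSignedDist_of_pos (h : 0 < F x) :
    zeroSetSignedDist F x = infDist x (F ⁻¹' {0}) := if_pos h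

theorem zeroSetSignedDist_of_nonpos (h : F x ≤ 0) :
    zeroSetSignedDist F x = -infDist x (F ⁻¹' {0}) := if_neg h.not_gt

theorem zeroSetSignedDist_of_eq_zero (h : F x = 0) : zeroSetSignedDist F x = 0 := by
  rw [zeroSetSignedDist_of_nonpos h.le, infDist_zero_of_mem (by exact h), neg_zero]

theorem pos_of_zeroSetSignedDist_pos (h : 0 < zeroSetSignedDist F x) : 0 < F x := by
  by_contra hF
  rw [zeroSetSignedDist_of_nonpos (not_lt.mp hF)] at h
  linarith [infDist_nonneg (x := x) (s := F ⁻¹' {0})]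

theorem zeroSetSignedDist_neg (F : V → ℝ) (x : V) :
    zeroSetSignedDist (fun z => -F z) x = -zeroSetSignedDist F x := by
  have hset := neg_preimage_zero F
  rcases lt_trichotomy (F x) 0 with h | h | h
  · rw [zeroSetSignedDist_of_pos (by linarith), zeroSetSignedDist_of_nonpos h.le, hset, neg_neg]
  · rw [zeroSetSignedDist_of_eq_zero h, zeroSetSignedDist_of_eq_zero (by rw [h, neg_zero]),
      neg_zero]
  · rw [zeroSetSignedDist_of_nonpos (by linarith), zeroSetSignedDist_of_pos h, hset]

variable [NormedSpace ℝ V]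

theorem infDist_zeroSet_add_infDist_le (hF : Continuous F) (hx : 0 < F x) (hy : F y ≤ 0) :
    infDist x (F ⁻¹' {0}) + infDist y (F ⁻¹' {0}) ≤ dist x y := by
  obtain ⟨z, hz, hFz⟩ : ∃ z ∈ segment ℝ y x, F z = 0 := by
    have := (convex_segment (𝕜 := ℝ) y x).isPreconnected.intermediate_value
      (left_mem_segment ℝ y x) (right_mem_segment ℝ y x) hF.continuousOn
    exact this ⟨hy, hx.le⟩
  have h := dist_add_dist_of_mem_segment hz
  have h1 : infDist x (F ⁻¹' {0}) ≤ dist x z := infDist_le_dist_of_mem hFz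
  have h2 : infDist y (F ⁻¹' {0}) ≤ dist y z := infDist_le_dist_of_mem hFz
  rw [dist_comm x y]
  rw [dist_comm x z] at h1
  linarith

theorem abs_zeroSetSignedDist_sub_le (hF : Continuous F) (x y : V) :
    |zeroSetSignedDist F x - zeroSetSignedDist F y| ≤ dist x y := by
  have key : ∀ x y, zeroSetSignedDist F x - zeroSetSignedDist F y ≤ dist x y := by
    intro x y
    have hxy := infDist_le_infDist_add_dist (s := F ⁻¹' {0}) (x := x) (y := y)
    have hyx := infDist_le_infDist_add_dist (s := F ⁻¹' {0}) (x := y) (y := x)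
    rw [dist_comm y x] at hyx
    have hx0 := infDist_nonneg (x := x) (s := F ⁻¹' {0})
    have hy0 := infDist_nonneg (x := y) (s := F ⁻¹' {0})
    rcases lt_or_ge 0 (F x) with hx | hx <;> rcases lt_or_ge 0 (F y) with hy | hy
    · rw [zeroSetSignedDist_of_pos hx, zeroSetSignedDist_of_pos hy]
      linarith
    · rw [zeroSetSignedDist_of_pos hx, zeroSetSignedDist_of_nonpos hy]
      linarith [infDist_zeroSet_add_infDist_le hF hx hy]
    · rw [zeroSetSignedDist_of_nonpos hx, zeroSetSignedDist_of_pos hy]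
      linarith [dist_nonneg (x := x) (y := y)]
    · rw [zeroSetSignedDist_of_nonpos hx, zeroSetSignedDist_of_nonpos hy]
      linarith
  refine abs_le.mpr ⟨?_, key x y⟩
  have := key y x
  rw [dist_comm] at this
  linarith

theorem continuous_zeroSetSignedDist (hF : Continuous F) : Continuous (zeroSetSignedDist F) :=
  (LipschitzWith.of_dist_le_mul (K := 1) fun x y => by
    rw [NNReal.coe_one, one_mul, Real.dist_eq]
    exact abs_zeroSetSignedDist_sub_le hF x y).continuous

end SignedDistance

section MedialAxis

local notation "E" => EuclideanSpace ℝ (Fin 3)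

/-- Away from the medial axis, the distance to `S` increases in every direction that makes an
acute angle with the direction away from the nearest point. -/
theorem eventually_infDist_lt_infDist_add_smul {S : Set E} (hS : IsCompact S) {y p v : E}
    (hy : y ∉ medialAxis S) (hp : p ∈ S) (hyp : dist y p = infDist y S)
    (hv : 0 < inner ℝ v (y - p)) :
    ∀ᶠ s in 𝓝[>] (0 : ℝ), infDist y S < infDist (y + s • v) S := by
  have hfar : ∃ η > 0, ∀ z ∈ S, inner ℝ v (y - z) ≤ 0 → infDist y S + η ≤ dist y z := by
    have hK : IsCompact (S ∩ {z | inner ℝ v (y - z) ≤ 0}) :=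
      hS.inter_right (isClosed_le (by fun_prop) continuous_const)
    rcases (S ∩ {z | inner ℝ v (y - z) ≤ 0}).eq_empty_or_nonempty with hemp | hne
    · refine ⟨1, one_pos, fun z hz hvz => ?_⟩
      exact absurd (show z ∈ S ∩ {z | inner ℝ v (y - z) ≤ 0} from ⟨hz, hvz⟩) (by simp [hemp])
    · obtain ⟨z₀, ⟨hz₀, hvz₀⟩, hmin⟩ := hK.exists_isMinOn hne
        (f := fun z => dist y z) (by fun_prop)
      have hlt : infDist y S < dist y z₀ := by
        refine lt_of_le_of_ne (infDist_le_dist_of_mem hz₀) fun heq => hy ?_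
        refine subset_closure ⟨p, hp, z₀, hz₀, ?_, hyp, heq.symm⟩
        rintro rfl
        exact absurd hvz₀ (not_le.mpr hv)
      refine ⟨dist y z₀ - infDist y S, sub_pos.mpr hlt, fun z hz hvz => ?_⟩
      have : dist y z₀ ≤ dist y z := hmin ⟨hz, hvz⟩
      linarith
  obtain ⟨η, hη, hfar⟩ := hfar
  have hsmall : ∀ᶠ s in 𝓝[>] (0 : ℝ), ‖s • v‖ < η := by
    have : Tendsto (fun s : ℝ => ‖s • v‖) (𝓝[>] 0) (𝓝 ‖(0 : ℝ) • v‖) :=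
      Tendsto.mono_left (Continuous.tendsto (by fun_prop) 0) nhdsWithin_le_nhds
    exact this.eventually_lt_const (by simpa using hη)
  filter_upwards [hsmall, self_mem_nhdsWithin] with s hs hs0
  have hs0 : 0 < s := hs0
  obtain ⟨z, hz, hzd⟩ := hS.exists_infDist_eq_dist ⟨p, hp⟩ (y + s • v)
  rw [hzd]
  rcases le_or_gt (inner ℝ v (y - z)) 0 with hvz | hvz
  · have h1 := hfar z hz hvz
    have h2 := dist_triangle y (y + s • v) z
    rw [dist_self_add_right] at h2
    linarith
  · refine (infDist_le_dist_of_mem hz).trans_lt ?_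
    rw [dist_eq_norm, dist_eq_norm]
    refine lt_of_pow_lt_pow_left₀ 2 (norm_nonneg _) ?_
    rw [show y + s • v - z = (y - z) + s • v by abel, norm_add_sq_real, real_inner_smul_right,
      real_inner_comm]
    nlinarith [mul_pos hs0 hvz, sq_nonneg ‖s • v‖]

variable {F : E → ℝ}

theorem notMem_medialAxis_of_infDist_pos {S : Set E} {x : E}
    (h : 0 < infDist x (medialAxis S)) : x ∉ medialAxis S := fun hx =>
  h.ne' (infDist_zero_of_mem hx)

/-- If the local feature size of `x` exceeds `t`, the signed distance grows by `t` when moving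
away from the nearest point `p` by `t`, provided `t` does not exceed the distance to `p`. -/
theorem zeroSetSignedDist_ray_step (hF : Continuous F) (hS : IsCompact (F ⁻¹' {0}))
    {p N : E} {h t : ℝ} (hp : F p = 0) (hN : ‖N‖ = 1) (ht : 0 ≤ t) (hth : t ≤ h)
    (hδ : zeroSetSignedDist F (p + h • N) = h)
    (hf : t < infDist (p + h • N) (medialAxis (F ⁻¹' {0}))) :
    zeroSetSignedDist F (p + (h + t) • N) = h + t := by
  rcases ht.eq_or_lt with rfl | ht
  · simpa using hδ
  have hh : 0 < h := ht.trans_le hth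
  set x := p + h • N with hx
  obtain ⟨y, hyball, hymax⟩ := (isCompact_closedBall x t).exists_isMaxOn
    ⟨x, mem_closedBall_self ht.le⟩ (continuous_zeroSetSignedDist hF).continuousOn
  have hymax : ∀ z, dist z x ≤ t → zeroSetSignedDist F z ≤ zeroSetSignedDist F y :=
    fun z hz => hymax hz
  have hyx : dist y x ≤ t := hyball
  have hδy : h ≤ zeroSetSignedDist F y := hδ ▸ hymax x (by simpa using ht.le)
  have hFy : 0 < F y := pos_of_zeroSetSignedDist_pos (hh.trans_le hδy)
  have hyM : y ∉ medialAxis (F ⁻¹' {0}) := by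
    refine notMem_medialAxis_of_infDist_pos ?_
    have := infDist_le_infDist_add_dist (s := medialAxis (F ⁻¹' {0})) (x := x) (y := y)
    rw [dist_comm x y] at this
    linarith
  obtain ⟨p', hp', hyp'⟩ := hS.exists_infDist_eq_dist ⟨p, hp⟩ y
  have hgrow : ∀ v : E, 0 < inner ℝ v (y - p') →
      (∀ᶠ s in 𝓝[>] (0 : ℝ), dist (y + s • v) x ≤ t) → False := by
    intro v hv hball
    have hcont : Tendsto (fun s : ℝ => F (y + s • v)) (𝓝[>] 0) (𝓝 (F (y + (0 : ℝ) • v))) :=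
      Tendsto.mono_left (Continuous.tendsto (by fun_prop) 0) nhdsWithin_le_nhds
    have hpos := hcont.eventually_const_lt (by simpa using hFy : (0 : ℝ) < _)
    obtain ⟨s, h1, h2, h3⟩ := (hball.and (hpos.and
      (eventually_infDist_lt_infDist_add_smul hS hyM hp' hyp'.symm hv))).exists
    have := hymax _ h1
    rw [zeroSetSignedDist_of_pos h2, zeroSetSignedDist_of_pos hFy] at this
    linarith
  have hδy' := zeroSetSignedDist_of_pos hFy
  have hyp'pos : 0 < ‖y - p'‖ := by
    rw [← dist_eq_norm, ← hyp', ← hδy']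
    linarith
  have hyxt : ‖x - y‖ = t := by
    rw [← dist_eq_norm, dist_comm]
    refine le_antisymm hyx (not_lt.mp fun hlt => hgrow (y - p') ?_ ?_)
    · rw [real_inner_self_eq_norm_sq]
      positivity
    · have hcont : Tendsto (fun s : ℝ => dist (y + s • (y - p')) x) (𝓝[>] 0)
          (𝓝 (dist (y + (0 : ℝ) • (y - p')) x)) :=
        Tendsto.mono_left (Continuous.tendsto (by fun_prop) 0) nhdsWithin_le_nhds
      exact (hcont.eventually_lt_const (by simpa using hlt)).mono fun _ hs => hs.le
  have hray : ‖p' - y‖ • (x - y) = ‖x - y‖ • (p' - y) := by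
    refine norm_smul_eq_norm_smul_of_forall_inner fun v hv => not_lt.mp fun hneg => ?_
    refine hgrow v ?_ ?_
    · rw [← neg_sub p' y, inner_neg_right]
      linarith
    · filter_upwards [eventually_norm_sub_smul_lt hv] with s hs
      rw [dist_comm, dist_eq_norm, ← sub_sub, ← hyxt]
      exact hs.le
  set D := zeroSetSignedDist F y with hD
  have hDpos : 0 < D := hh.trans_le hδy
  have hp'y : ‖p' - y‖ = D := by
    rw [norm_sub_rev, ← dist_eq_norm, ← hyp', hδy']
  rw [hp'y, hyxt] at hray
  have hFx : 0 < F x := pos_of_zeroSetSignedDist_pos (hδ ▸ hh)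
  have hinf : infDist x (F ⁻¹' {0}) = h := (zeroSetSignedDist_of_pos hFx).symm.trans hδ
  have hxy : D • (x - p') = (D - t) • (y - p') := by
    rw [← sub_add_sub_cancel x y p', smul_add, hray]
    module
  have hxp' : dist x p' = D - t := by
    have := congrArg norm hxy
    rw [norm_smul, norm_smul, Real.norm_of_nonneg hDpos.le,
      Real.norm_of_nonneg (by linarith : 0 ≤ D - t), norm_sub_rev y p', hp'y, mul_comm] at this
    rw [dist_eq_norm]
    exact mul_right_cancel₀ hDpos.ne' this
  have hDle : D ≤ h + t := by
    have := (abs_le.mp (abs_zeroSetSignedDist_sub_le hF y x)).2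
    rw [hδ] at this
    linarith
  have hle : infDist x (F ⁻¹' {0}) ≤ dist x p' := infDist_le_dist_of_mem hp'
  have hDeq : D = h + t := by linarith
  have hxM : x ∉ medialAxis (F ⁻¹' {0}) := notMem_medialAxis_of_infDist_pos (ht.trans hf)
  have hpp' : p = p' := by
    by_contra hne
    refine hxM (subset_closure ⟨p, hp, p', hp', hne, ?_, ?_⟩)
    · rw [hinf, hx, dist_eq_norm, add_sub_cancel_left, norm_smul, hN, mul_one,
        Real.norm_of_nonneg hh.le]
    · linarith
  subst hpp'
  have hy : y = p + (h + t) • N := by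
    rw [hDeq, hx, add_sub_cancel_left, add_sub_cancel_right, smul_comm] at hxy
    rw [smul_right_injective E hh.ne' hxy]
    abel
  rw [← hy, ← hDeq]

theorem zeroSetSignedDist_ray (hF : Continuous F) (hS : IsCompact (F ⁻¹' {0}))
    {p N : E} {h t : ℝ} (hp : F p = 0) (hN : ‖N‖ = 1) (hh : 0 < h) (ht : 0 ≤ t)
    (hδ : zeroSetSignedDist F (p + h • N) = h)
    (hf : t < infDist (p + h • N) (medialAxis (F ⁻¹' {0}))) :
    zeroSetSignedDist F (p + (h + t) • N) = h + t := by
  obtain ⟨n, hn⟩ := exists_nat_ge (t / h)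
  rw [div_le_iff₀ hh] at hn
  induction n generalizing t with
  | zero =>
    exact zeroSetSignedDist_ray_step hF hS hp hN ht (by simp at hn; linarith) hδ hf
  | succ n ih =>
    rcases le_or_gt t h with hth | hth
    · exact zeroSetSignedDist_ray_step hF hS hp hN ht hth hδ hf
    push_cast at hn
    have hprev := ih (t := t - h) (by linarith) (by linarith) (by linarith)
    rw [add_sub_cancel] at hprev
    have hdist : dist (p + h • N) (p + t • N) = t - h := by
      rw [dist_add_left, dist_comm, dist_eq_norm, ← sub_smul, norm_smul, hN, mul_one,
        Real.norm_of_nonneg (by linarith)]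
    have hlfs := infDist_le_infDist_add_dist (s := medialAxis (F ⁻¹' {0})) (x := p + h • N)
      (y := p + t • N)
    rw [add_comm h t]
    exact zeroSetSignedDist_ray_step hF hS hp hN hh.le hth.le hprev (by linarith)

theorem tendsto_slope_gradient (hF : Differentiable ℝ F) (p v : E) :
    Tendsto (fun s : ℝ => s⁻¹ * (F (p + s • v) - F p)) (𝓝[>] 0)
      (𝓝 (inner ℝ v (gradient F p))) := by
  have hline : HasDerivAt (fun s : ℝ => p + s • v) v 0 := by
    simpa using ((hasDerivAt_id (0 : ℝ)).smul_const v).const_add p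
  have hFd : HasFDerivAt F (fderiv ℝ F p) (p + (0 : ℝ) • v) := by
    simpa using (hF p).hasFDerivAt
  have h := (hFd.comp_hasDerivAt (0 : ℝ) hline).tendsto_slope_zero_right
  rw [real_inner_comm, inner_gradient_left]
  simpa using h

/-- If `p` is a nearest zero of `F` to a point `x` with `F x > 0`, then `x` lies on the ray from
`p` in the direction of the gradient. -/
theorem eq_add_smul_unit_gradient (hF : Differentiable ℝ F) {x p : E} (hx : 0 < F x)
    (hp : F p = 0) (hgrad : gradient F p ≠ 0) (hxp : dist x p = infDist x (F ⁻¹' {0})) :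
    x = p + dist x p • (‖gradient F p‖⁻¹ • gradient F p) := by
  have hray : ‖gradient F p‖ • (x - p) = ‖x - p‖ • gradient F p := by
    refine norm_smul_eq_norm_smul_of_forall_inner fun v hv => ?_
    refine ge_of_tendsto (tendsto_slope_gradient hF p v) ?_
    filter_upwards [eventually_norm_sub_smul_lt hv, self_mem_nhdsWithin] with s hs hs0
    have hs0 : 0 < s := hs0
    have hclose := (abs_le.mp (abs_zeroSetSignedDist_sub_le hF.continuous x (p + s • v))).2
    rw [dist_eq_norm, ← sub_sub, zeroSetSignedDist_of_pos hx, ← hxp, dist_eq_norm] at hclose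
    have hpos : 0 < F (p + s • v) := pos_of_zeroSetSignedDist_pos (by linarith)
    rw [hp, sub_zero]
    positivity
  rw [dist_eq_norm, smul_comm, ← hray, inv_smul_smul₀ (norm_ne_zero_iff.mpr hgrad)]
  abel

theorem continuous_gradient_of_contDiff (hF : ContDiff ℝ 1 F) : Continuous (gradient F) :=
  (InnerProductSpace.toDual ℝ E).symm.continuous.comp (hF.continuous_fderiv one_ne_zero)

theorem norm_unit_gradient {p : E} (h : gradient F p ≠ 0) :
    ‖‖gradient F p‖⁻¹ • gradient F p‖ = 1 := norm_smul_inv_norm h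

/-- The signed distance is linear along the normal ray at a nearest point. -/
theorem zeroSetSignedDist_add_smul_unit_gradient (hF : Differentiable ℝ F)
    (hS : IsCompact (F ⁻¹' {0})) {x p : E} {t : ℝ} (hx : 0 < F x) (hp : F p = 0)
    (hgrad : gradient F p ≠ 0) (hxp : dist x p = infDist x (F ⁻¹' {0})) (ht : 0 ≤ t)
    (hf : t < infDist x (medialAxis (F ⁻¹' {0}))) :
    zeroSetSignedDist F (x + t • (‖gradient F p‖⁻¹ • gradient F p)) =
      zeroSetSignedDist F x + t := by
  have hpos : 0 < dist x p := by
    rw [dist_pos]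
    rintro rfl
    exact hx.ne' hp
  have heq := eq_add_smul_unit_gradient hF hx hp hgrad hxp
  have hδ : zeroSetSignedDist F x = dist x p := (zeroSetSignedDist_of_pos hx).trans hxp.symm
  have h := zeroSetSignedDist_ray hF.continuous hS hp (norm_unit_gradient hgrad) hpos ht
    (by rw [← heq, hδ]) (by rw [← heq]; exact hf)
  rwa [add_smul, ← add_assoc, ← heq, ← hδ] at h

/-- A ball that touches the zero set at `p` from the positive side, with radius below the local
feature size of `p`, has no zero of `F` in its interior. -/
theorem zeroSetSignedDist_zero_add_smul_unit_gradient (hF : ContDiff ℝ 1 F)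
    (hS : IsCompact (F ⁻¹' {0})) (hgrad : ∀ p, F p = 0 → gradient F p ≠ 0) {p : E} {t : ℝ}
    (hp : F p = 0) (ht : 0 ≤ t) (hf : t < infDist p (medialAxis (F ⁻¹' {0}))) :
    zeroSetSignedDist F (p + t • (‖gradient F p‖⁻¹ • gradient F p)) = t := by
  have hFd : Differentiable ℝ F := hF.differentiable one_ne_zero
  have hδc := continuous_zeroSetSignedDist hFd.continuous
  choose π hπ hπd using hS.exists_infDist_eq_dist ⟨p, hp⟩
  set x : ℝ → E := fun s => p + s • gradient F p
  have hxlim : Tendsto x (𝓝[>] 0) (𝓝 p) := by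
    have hc : Continuous x := by fun_prop
    simpa [x] using (hc.tendsto 0).mono_left nhdsWithin_le_nhds
  have hπlim : Tendsto (fun s => π (x s)) (𝓝[>] 0) (𝓝 p) := by
    have h2 : Tendsto (fun s => 2 * dist (x s) p) (𝓝[>] 0) (𝓝 0) := by
      simpa using (tendsto_iff_dist_tendsto_zero.mp hxlim).const_mul 2
    refine tendsto_iff_dist_tendsto_zero.mpr
      (squeeze_zero (fun _ => dist_nonneg) (fun s => ?_) h2)
    have h3 : infDist (x s) (F ⁻¹' {0}) ≤ dist (x s) p := infDist_le_dist_of_mem hp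
    have h4 := dist_triangle_left (π (x s)) p (x s)
    rw [hπd] at h3
    linarith
  have hpos : ∀ᶠ s in 𝓝[>] (0 : ℝ), 0 < F (x s) := by
    have hslope := (tendsto_slope_gradient hFd p (gradient F p)).eventually_const_lt
      (u := 0) (real_inner_self_pos.mpr (hgrad p hp))
    filter_upwards [hslope, self_mem_nhdsWithin] with s hs hs0
    rw [hp, sub_zero] at hs
    exact pos_of_mul_pos_right hs (inv_nonneg.mpr (le_of_lt hs0))
  have hfar : ∀ᶠ s in 𝓝[>] (0 : ℝ), t < infDist (x s) (medialAxis (F ⁻¹' {0})) :=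
    (((continuous_infDist_pt _).tendsto p).comp hxlim).eventually_const_lt hf
  have hnormal : Tendsto (fun s => ‖gradient F (π (x s))‖⁻¹ • gradient F (π (x s))) (𝓝[>] 0)
      (𝓝 (‖gradient F p‖⁻¹ • gradient F p)) := by
    have hg := ((continuous_gradient_of_contDiff hF).tendsto p).comp hπlim
    exact (hg.norm.inv₀ (norm_ne_zero_iff.mpr (hgrad p hp))).smul hg
  have hleft := (hδc.tendsto _).comp (hxlim.add (hnormal.const_smul t))
  have hright := ((hδc.tendsto _).comp hxlim).add_const t
  rw [zeroSetSignedDist_of_eq_zero hp, zero_add] at hright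
  refine tendsto_nhds_unique (hleft.congr' ?_) hright
  filter_upwards [hpos, hfar] with s hs hfs
  exact zeroSetSignedDist_add_smul_unit_gradient hFd hS hs (hπ _) (hgrad _ (hπ _))
    (hπd _).symm ht hfs

theorem gradient_neg_fun (F : E → ℝ) (p : E) : gradient (fun z => -F z) p = -gradient F p := by
  rw [gradient, gradient, ← map_neg]
  congr 1
  exact fderiv_fun_neg

theorem zeroSetSignedDist_normal_line (hF : ContDiff ℝ 1 F)
    (hS : IsCompact (F ⁻¹' {0})) (hgrad : ∀ p, F p = 0 → gradient F p ≠ 0) {p : E} {t : ℝ}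
    (hp : F p = 0) (hf : |t| < infDist p (medialAxis (F ⁻¹' {0}))) :
    zeroSetSignedDist F (p + t • (‖gradient F p‖⁻¹ • gradient F p)) = t := by
  rcases le_total 0 t with ht | ht
  · rw [abs_of_nonneg ht] at hf
    exact zeroSetSignedDist_zero_add_smul_unit_gradient hF hS hgrad hp ht hf
  · rw [abs_of_nonpos ht] at hf
    have hset := neg_preimage_zero F
    have h := zeroSetSignedDist_zero_add_smul_unit_gradient (F := fun z => -F z) (p := p)
      (t := -t) hF.neg (by rwa [hset])
      (fun z hz => by
        rw [gradient_neg_fun]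
        exact neg_ne_zero.mpr (hgrad z (neg_eq_zero.mp hz)))
      (by rw [hp, neg_zero]) (by linarith) (by rwa [hset])
    rw [zeroSetSignedDist_neg, gradient_neg_fun, norm_neg, smul_neg, smul_neg, neg_smul,
      neg_neg] at h
    linarith

/-- `N` is a unit vector along which the signed distance to the zero set of `F` is calibrated
at distance `s` on both sides of `x`. -/
structure IsCalibrated (F : E → ℝ) (s : ℝ) (x N : E) : Prop where
  norm_eq : ‖N‖ = 1
  forward : zeroSetSignedDist F (x + s • N) = zeroSetSignedDist F x + s
  backward : zeroSetSignedDist F (x - s • N) = zeroSetSignedDist F x - s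

theorem IsCalibrated.norm_sub_mul_le (hF : Continuous F) {s : ℝ} {x y N N' : E} (hs : 0 ≤ s)
    (hx : IsCalibrated F s x N) (hy : IsCalibrated F s y N') :
    ‖N - N'‖ * s ≤ dist x y := by
  rcases le_or_gt (dist x y) (2 * s) with h | h
  · have hxy := (abs_le.mp (abs_zeroSetSignedDist_sub_le hF (x + s • N) (y - s • N'))).2
    have hyx := (abs_le.mp (abs_zeroSetSignedDist_sub_le hF (y + s • N') (x - s • N))).2
    rw [hx.forward, hy.backward, dist_eq_norm,
      show x + s • N - (y - s • N') = (x - y) + s • (N + N') by module] at hxy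
    rw [hy.forward, hx.backward, dist_eq_norm,
      show y + s • N' - (x - s • N) = -(x - y) + s • (N + N') by module] at hyx
    rw [dist_eq_norm]
    exact norm_sub_mul_le_of_le_norm_add hs hx.norm_eq hy.norm_eq
      ((abs_zeroSetSignedDist_sub_le hF x y).trans h) (by linarith) (by linarith)
  · have := norm_sub_le N N'
    rw [hx.norm_eq, hy.norm_eq] at this
    nlinarith

theorem isCalibrated_unit_gradient (hF : ContDiff ℝ 1 F) (hS : IsCompact (F ⁻¹' {0}))
    (hgrad : ∀ p, F p = 0 → gradient F p ≠ 0) {p : E} {s : ℝ} (hp : F p = 0) (hs : 0 ≤ s)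
    (hf : s < infDist p (medialAxis (F ⁻¹' {0}))) :
    IsCalibrated F s p (‖gradient F p‖⁻¹ • gradient F p) where
  norm_eq := norm_unit_gradient (hgrad p hp)
  forward := by
    rw [zeroSetSignedDist_of_eq_zero hp, zero_add]
    exact zeroSetSignedDist_normal_line hF hS hgrad hp (by rwa [abs_of_nonneg hs])
  backward := by
    rw [zeroSetSignedDist_of_eq_zero hp, zero_sub, sub_eq_add_neg, ← neg_smul]
    exact zeroSetSignedDist_normal_line hF hS hgrad hp (by rwa [abs_neg, abs_of_nonneg hs])

theorem exists_isCalibrated_of_pos (hF : ContDiff ℝ 1 F) (hS : IsCompact (F ⁻¹' {0}))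
    (hne : (F ⁻¹' {0}).Nonempty) (hgrad : ∀ p, F p = 0 → gradient F p ≠ 0) {x : E} {s : ℝ}
    (hx : 0 < F x) (hs : 0 < s) (hf : s < infDist x (medialAxis (F ⁻¹' {0})))
    (hd : 2 * infDist x (F ⁻¹' {0}) ≤ infDist x (medialAxis (F ⁻¹' {0}))) :
    ∃ N, IsCalibrated F s x N := by
  have hFd : Differentiable ℝ F := hF.differentiable one_ne_zero
  obtain ⟨p, hp, hxp⟩ := hS.exists_infDist_eq_dist hne x
  refine ⟨‖gradient F p‖⁻¹ • gradient F p, norm_unit_gradient (hgrad p hp),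
    zeroSetSignedDist_add_smul_unit_gradient hFd hS hx hp (hgrad p hp) hxp.symm hs.le hf, ?_⟩
  have heq := eq_add_smul_unit_gradient hFd hx hp (hgrad p hp) hxp.symm
  have hlfs := infDist_le_infDist_add_dist (s := medialAxis (F ⁻¹' {0})) (x := x) (y := p)
  have h := zeroSetSignedDist_normal_line hF hS hgrad (p := p) (t := dist x p - s) hp
    (abs_lt.mpr ⟨by linarith, by linarith⟩)
  rwa [sub_smul, ← add_sub_assoc, ← heq, ← hxp, ← zeroSetSignedDist_of_pos hx] at h

theorem exists_isCalibrated (hF : ContDiff ℝ 1 F) (hS : IsCompact (F ⁻¹' {0}))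
    (hne : (F ⁻¹' {0}).Nonempty) (hgrad : ∀ p, F p = 0 → gradient F p ≠ 0) {x : E} {s : ℝ}
    (hs : 0 < s) (hf : s < infDist x (medialAxis (F ⁻¹' {0})))
    (hd : 2 * infDist x (F ⁻¹' {0}) ≤ infDist x (medialAxis (F ⁻¹' {0}))) :
    ∃ N, IsCalibrated F s x N := by
  rcases lt_trichotomy (F x) 0 with hx | hx | hx
  · have hset := neg_preimage_zero F
    obtain ⟨N, h1, h2, h3⟩ := exists_isCalibrated_of_pos (F := fun z => -F z) (x := x) (s := s)
      hF.neg (by rwa [hset]) (by rwa [hset])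
      (fun z hz => by
        rw [gradient_neg_fun]
        exact neg_ne_zero.mpr (hgrad z (neg_eq_zero.mp hz)))
      (by linarith) hs (by rwa [hset]) (by rwa [hset])
    simp only [zeroSetSignedDist_neg] at h2 h3
    refine ⟨-N, by rwa [norm_neg], ?_, ?_⟩
    · rw [smul_neg, ← sub_eq_add_neg]
      linarith
    · rw [smul_neg, sub_neg_eq_add]
      linarith
  · exact ⟨_, isCalibrated_unit_gradient hF hS hgrad hx hs.le hf⟩
  · exact exists_isCalibrated_of_pos hF hS hne hgrad hx hs hf hd

end MedialAxis

/-- If, for every `n`, two vectors are joined by a chain of unit vectors with `n` chords of length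
at most `L / n`, then the angle between them is at most `L`. -/
theorem angle_le_of_forall_chain {V : Type*} [NormedAddCommGroup V] [InnerProductSpace ℝ V]
    {u w : V} {L : ℝ} (h : ∀ n : ℕ, 0 < n → ∃ N : ℕ → V, N 0 = u ∧ N n = w ∧
      (∀ i ≤ n, ‖N i‖ = 1) ∧ ∀ i < n, ‖N i - N (i + 1)‖ ≤ L / n) :
    angle u w ≤ L := by
  have hlim : Tendsto (fun n : ℕ => L + L ^ 3 * ((n : ℝ)⁻¹ * (n : ℝ)⁻¹)) atTop
      (𝓝 (L + L ^ 3 * (0 * 0))) :=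
    ((tendsto_inv_atTop_nhds_zero_nat.mul tendsto_inv_atTop_nhds_zero_nat).const_mul _).const_add _
  rw [mul_zero, mul_zero, add_zero] at hlim
  refine ge_of_tendsto hlim ?_
  filter_upwards [eventually_gt_atTop 0] with n hn
  obtain ⟨N, rfl, rfl, h1, h2⟩ := h n hn
  refine (angle_chain_le h1 h2).trans_eq ?_
  have : (n : ℝ) ≠ 0 := by positivity
  field_simp

/-- Normal variation theorem: if `q, q' ∈ Σ` with `dist q q' ≤ ε · f q`,
`0 < ε ≤ 1/3`, then the angle between the unit normals is at most `dist q q' / ((1-ε)·f q)`. -/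
theorem normal_variation_intermediate
    (F : EuclideanSpace ℝ (Fin 3) → ℝ) (hF : ContDiff ℝ (⊤ : ℕ∞) F)
    (S : Set (EuclideanSpace ℝ (Fin 3))) (hS : S = F ⁻¹' {0})
    (hScomp : IsCompact S)
    (hgrad : ∀ p ∈ S, gradient F p ≠ 0)
    (M : Set (EuclideanSpace ℝ (Fin 3))) (hM : M = medialAxis S)
    (hMne : M.Nonempty)
    (f : EuclideanSpace ℝ (Fin 3) → ℝ) (hf : ∀ x, f x = Metric.infDist x M)
    (q q' : EuclideanSpace ℝ (Fin 3)) (hq : q ∈ S) (hq' : q' ∈ S)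
    (ε : ℝ) (hε0 : 0 < ε) (hε : ε ≤ 1/3)
    (hd : dist q q' ≤ ε * f q) :
    InnerProductGeometry.angle
      ((‖gradient F q‖)⁻¹ • gradient F q)
      ((‖gradient F q'‖)⁻¹ • gradient F q') ≤ dist q q' / ((1 - ε) * f q) := by
  subst hS hM
  have hgrad' : ∀ p, F p = 0 → gradient F p ≠ 0 := hgrad
  have hF1 : ContDiff ℝ 1 F := hF.of_le (by exact_mod_cast le_top)
  rcases (hf q ▸ infDist_nonneg : 0 ≤ f q).eq_or_lt with hfq | hfq
  · rw [← hfq, mul_zero] at hd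
    rw [dist_le_zero.mp hd, angle_self (norm_ne_zero_iff.mp
      (by rw [norm_unit_gradient (hgrad q' hq')]; exact one_ne_zero))]
    simp
  have hR : 0 < (1 - ε) * f q := mul_pos (by linarith) hfq
  have hεf : ε * f q ≤ 1 / 3 * f q := mul_le_mul_of_nonneg_right hε hfq.le
  have hlfs : ∀ x, dist q x ≤ dist q q' → (1 - ε) * f q ≤ infDist x (medialAxis (F ⁻¹' {0})) := by
    intro x hx
    have := infDist_le_infDist_add_dist (s := medialAxis (F ⁻¹' {0})) (x := q) (y := x)
    rw [← hf] at this
    linarith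
  suffices hsmall : ∀ s, 0 < s → s < (1 - ε) * f q →
      angle ((‖gradient F q‖)⁻¹ • gradient F q) ((‖gradient F q'‖)⁻¹ • gradient F q') ≤
        dist q q' / s by
    have hlim : Tendsto (fun s => dist q q' / s) (𝓝[<] ((1 - ε) * f q))
        (𝓝 (dist q q' / ((1 - ε) * f q))) :=
      (tendsto_const_nhds.div tendsto_id hR.ne').mono_left nhdsWithin_le_nhds
    refine ge_of_tendsto hlim ?_
    filter_upwards [Ioo_mem_nhdsLT hR] with s hs
    exact hsmall s hs.1 hs.2
  intro s hs hsR
  have hcal : ∀ x, dist q x ≤ dist q q' → ∃ N, IsCalibrated F s x N := by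
    intro x hx
    refine exists_isCalibrated hF1 hScomp ⟨q, hq⟩ hgrad' hs (hsR.trans_le (hlfs x hx)) ?_
    have h1 : infDist x (F ⁻¹' {0}) ≤ dist x q := infDist_le_dist_of_mem hq
    rw [dist_comm] at h1
    linarith [hlfs x hx]
  refine angle_le_of_forall_chain fun n hn => ?_
  have hn' : (0 : ℝ) < n := by exact_mod_cast hn
  set x : ℕ → EuclideanSpace ℝ (Fin 3) := fun i => AffineMap.lineMap q q' ((i : ℝ) / n) with hx
  have hxq : ∀ i ≤ n, dist q (x i) ≤ dist q q' := by
    intro i hi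
    rw [hx, dist_left_lineMap, Real.norm_of_nonneg (by positivity)]
    refine mul_le_of_le_one_left dist_nonneg ((div_le_one hn').mpr ?_)
    exact_mod_cast hi
  have hN : ∀ i, ∃ N, i ≤ n → IsCalibrated F s (x i) N := by
    intro i
    by_cases hi : i ≤ n
    · obtain ⟨N, h⟩ := hcal (x i) (hxq i hi)
      exact ⟨N, fun _ => h⟩
    · exact ⟨0, fun h => absurd h hi⟩
  choose N hN using hN
  have huniq : ∀ {z u w}, IsCalibrated F s z u → IsCalibrated F s z w → u = w := by
    intro z u w hu hw
    have h := hu.norm_sub_mul_le hF.continuous hs.le hw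
    rw [dist_self] at h
    exact sub_eq_zero.mp (norm_le_zero_iff.mp (nonpos_of_mul_nonpos_left h hs))
  refine ⟨N, ?_, ?_, fun i hi => (hN i hi).norm_eq, fun i hi => ?_⟩
  · have h := hN 0 (Nat.zero_le n)
    rw [hx] at h
    simp only [Nat.cast_zero, zero_div, AffineMap.lineMap_apply_zero] at h
    exact huniq h (isCalibrated_unit_gradient hF1 hScomp hgrad' hq hs.le
      (hsR.trans_le (hlfs q (by simp))))
  · have h := hN n le_rfl
    rw [hx] at h
    simp only [div_self hn'.ne', AffineMap.lineMap_apply_one] at h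
    exact huniq h (isCalibrated_unit_gradient hF1 hScomp hgrad' hq' hs.le
      (hsR.trans_le (hlfs q' le_rfl)))
  · have h := (hN i hi.le).norm_sub_mul_le hF.continuous hs.le (hN (i + 1) hi)
    rw [hx, dist_lineMap_lineMap, Real.dist_eq, ← sub_div, Nat.cast_add_one,
      sub_add_cancel_left, abs_div, abs_neg, abs_one, abs_of_pos hn'] at h
    rw [div_div, le_div_iff₀ (by positivity)]
    rw [one_div_mul_eq_div, le_div_iff₀ hn'] at h
    linarith
end

section
/- Let Σ ⊂ ℝ³ be a compact smooth surface with medial axis M, and let h : ℝ³ → ℝ be the distance function h(x) = infDist x Σ. Then at every point p ∈ ℝ³ with p ∉ Σ and p ∉ M, the function h is differentiable, its nearest point p̃ in Σ is unique, and the gradient of h at p is the unit vector (p - p̃)/‖p - p̃‖; in particular ‖gradient h p‖ = 1. -/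
open Metric Set

open Filter Topology

section NearestPoint

variable {E : Type*} [NormedAddCommGroup E] [InnerProductSpace ℝ E]

/-- The subgradient inequality for the norm of an inner product space. -/
theorem norm_sub_norm_le_inner_normalize (a b : E) :
    ‖a‖ - ‖b‖ ≤ inner ℝ (‖a‖⁻¹ • a) (a - b) := by
  rcases eq_or_ne a 0 with rfl | ha
  · simp
  have hpos : 0 < ‖a‖ := norm_pos_iff.2 ha
  have hab := real_inner_le_norm a b
  rw [real_inner_smul_left, inner_sub_right, real_inner_self_eq_norm_sq, inv_mul_eq_div,
    le_div_iff₀ hpos]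
  nlinarith

theorem tendsto_normalize {a : E} (ha : a ≠ 0) :
    Tendsto (fun x : E => ‖x‖⁻¹ • x) (𝓝 a) (𝓝 (‖a‖⁻¹ • a)) :=
  (continuousAt_id.norm.inv₀ (norm_ne_zero_iff.2 ha)).smul continuousAt_id

/-- A choice of nearest points in a compact set is continuous at every point whose nearest point
is unique. -/
theorem tendsto_nearestPoint_of_unique {X : Type*} [PseudoMetricSpace X] {S : Set X}
    (hS : IsCompact S) {p q : X}
    (huniq : ∀ y ∈ S, dist p y = infDist p S → y = q) {f : X → X} (hfS : ∀ x, f x ∈ S)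
    (hf : ∀ x, infDist x S = dist x (f x)) : Tendsto f (𝓝 p) (𝓝 q) := by
  have hdist : Tendsto (fun x => dist p (f x)) (𝓝 p) (𝓝 (infDist p S)) := by
    have hub : Tendsto (fun x => dist p x + infDist x S) (𝓝 p) (𝓝 (infDist p S)) := by
      have hc : Continuous fun x => dist p x + infDist x S :=
        (continuous_const.dist continuous_id).add (continuous_infDist_pt S)
      simpa using hc.tendsto p
    refine tendsto_of_tendsto_of_tendsto_of_le_of_le tendsto_const_nhds hub
      (fun x => infDist_le_dist_of_mem (hfS x)) fun x => ?_
    simpa only [hf x] using dist_triangle p x (f x)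
  refine hS.tendsto_nhds_of_unique_mapClusterPt (Eventually.of_forall hfS) fun y hy hcl => ?_
  refine huniq y hy ?_
  have hc : ContinuousAt (fun z => dist p z) y := by fun_prop
  have hcl' : MapClusterPt (dist p y) (𝓝 p) fun x => dist p (f x) := hcl.continuousAt_comp hc
  exact eq_of_nhds_neBot (hcl'.clusterPt.mono hdist).neBot

/-- The distance function to a compact set has gradient `(p - q) / ‖p - q‖` at a point `p` outside
the set whose unique nearest point is `q`. -/
theorem hasGradientAt_infDist_of_unique [CompleteSpace E] {S : Set E} (hS : IsCompact S) {p q : E}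
    (hpS : p ∉ S) (hqS : q ∈ S) (hq : dist p q = infDist p S)
    (huniq : ∀ y ∈ S, dist p y = infDist p S → y = q) :
    HasGradientAt (fun x => infDist x S) (‖p - q‖⁻¹ • (p - q)) p := by
  choose f hfS hf using hS.exists_infDist_eq_dist ⟨q, hqS⟩
  have hpq : p - q ≠ 0 := sub_ne_zero.2 fun e => hpS (e ▸ hqS)
  have hflim := tendsto_nearestPoint_of_unique hS huniq hfS hf
  have hupper : Tendsto (fun x => ‖x - q‖⁻¹ • (x - q)) (𝓝 p) (𝓝 (‖p - q‖⁻¹ • (p - q))) :=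
    (tendsto_normalize hpq).comp (tendsto_id.sub tendsto_const_nhds)
  have hlower : Tendsto (fun x => ‖p - f x‖⁻¹ • (p - f x)) (𝓝 p) (𝓝 (‖p - q‖⁻¹ • (p - q))) :=
    (tendsto_normalize hpq).comp (tendsto_const_nhds.sub hflim)
  rw [hasGradientAt_iff_isLittleO, Asymptotics.isLittleO_iff]
  intro c hc
  filter_upwards [hupper (closedBall_mem_nhds _ hc), hlower (closedBall_mem_nhds _ hc)]
    with x hxu hxl
  simp only [mem_preimage, mem_closedBall, dist_eq_norm] at hxu hxl
  have hbound : ∀ v : E, ‖v - ‖p - q‖⁻¹ • (p - q)‖ ≤ c →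
      |inner ℝ v (x - p) - inner ℝ (‖p - q‖⁻¹ • (p - q)) (x - p)| ≤ c * ‖x - p‖ := fun v hv => by
    rw [← inner_sub_left]
    exact (abs_real_inner_le_norm _ _).trans (mul_le_mul_of_nonneg_right hv (norm_nonneg _))
  have hbu := abs_le.1 (hbound _ hxu)
  have hbl := abs_le.1 (hbound _ hxl)
  have hsu := norm_sub_norm_le_inner_normalize (x - q) (p - q)
  have hsl := norm_sub_norm_le_inner_normalize (p - f x) (x - f x)
  rw [sub_sub_sub_cancel_right] at hsu hsl
  rw [← neg_sub x p, inner_neg_right] at hsl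
  have hxq := infDist_le_dist_of_mem (x := x) hqS
  have hpf := infDist_le_dist_of_mem (x := p) (hfS x)
  have hxf := hf x
  rw [dist_eq_norm] at hxq hpf hxf hq
  rw [Real.norm_eq_abs, abs_le]
  constructor <;> linarith

end NearestPoint

/-- Claim 2 of the paper (analytic content): away from the surface `Σ` and its
medial axis `M`, the distance function `h x = infDist x Σ` is differentiable,
the nearest point `p̃` of `p` in `Σ` is unique, and the gradient of `h` at `p`
is the unit vector `(p - p̃)/‖p - p̃‖`; in particular it has norm `1`. -/
theorem gradient_of_distance_function
    (F : EuclideanSpace ℝ (Fin 3) → ℝ) (hF : ContDiff ℝ (⊤ : ℕ∞) F)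
    (S : Set (EuclideanSpace ℝ (Fin 3))) (hS : S = F ⁻¹' {0})
    (hScomp : IsCompact S) (hSne : S.Nonempty)
    (hgrad : ∀ p ∈ S, gradient F p ≠ 0)
    (M : Set (EuclideanSpace ℝ (Fin 3))) (hM : M = medialAxis S)
    (h : EuclideanSpace ℝ (Fin 3) → ℝ) (hh : ∀ x, h x = Metric.infDist x S)
    (p : EuclideanSpace ℝ (Fin 3)) (hpS : p ∉ S) (hpM : p ∉ M) :
    DifferentiableAt ℝ h p ∧
    (∃! pt, pt ∈ S ∧ dist p pt = Metric.infDist p S) ∧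
    (∀ pt, pt ∈ S → dist p pt = Metric.infDist p S →
      gradient h p = (‖p - pt‖)⁻¹ • (p - pt)) ∧
    ‖gradient h p‖ = 1 := by
  subst hM
  obtain rfl : h = fun x => infDist x S := funext hh
  obtain ⟨q, hqS, hq⟩ := hScomp.exists_infDist_eq_dist hSne p
  have huniq : ∀ y ∈ S, dist p y = infDist p S → y = q := fun y hy hpy => by
    by_contra hne
    exact hpM (subset_closure ⟨y, hy, q, hqS, hne, hpy, hq.symm⟩)
  have hgr := hasGradientAt_infDist_of_unique hScomp hpS hqS hq.symm huniq
  have hpq : p - q ≠ 0 := sub_ne_zero.2 fun e => hpS (e ▸ hqS)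
  refine ⟨hgr.differentiableAt, ⟨q, ⟨hqS, hq.symm⟩, fun y hy => huniq y hy.1 hy.2⟩, ?_, ?_⟩
  · intro y hy hpy
    rw [huniq y hy hpy, hgr.gradient]
  · rw [hgr.gradient]
    exact norm_smul_inv_norm hpq
end

section
/- Let Σ ⊂ ℝ³ be a compact smooth surface with medial axis M and local feature size f. Let q ∈ Σ, let 0 < ε < 1/2, and let p ∈ ℝ³ with dist(q,p) ≤ ε·f(q). Let p̃ be a nearest point of p in Σ (i.e., p̃ ∈ Σ and dist(p,p̃) = infDist p Σ). Then dist(p, p̃) ≤ (2ε/(1-2ε))·f(p̃). In particular, for ε < 1/3, dist(p,p̃) < f(p̃). -/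
open Metric Set

/-- A function of class `C²` is, near each point, approximated by its first-order expansion with a
quadratic error that is uniform in the base point. -/
lemma exists_ball_abs_sub_sub_fderiv_le {E : Type*} [NormedAddCommGroup E] [NormedSpace ℝ E]
    {F : E → ℝ} (hF : ContDiff ℝ 2 F) (s : E) :
    ∃ K : ℝ, 0 ≤ K ∧ ∃ δ > 0, ∀ y ∈ ball s δ, ∀ z ∈ ball s δ,
      |F z - F y - fderiv ℝ F y (z - y)| ≤ K * ‖z - y‖ ^ 2 := by
  have hF' : ContDiff ℝ 1 (fderiv ℝ F) := hF.fderiv_right (by norm_num)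
  obtain ⟨K, t, ht, hK⟩ := hF'.contDiffAt.exists_lipschitzOnWith (x := s)
  obtain ⟨δ, hδ, hball⟩ := Metric.mem_nhds_iff.1 ht
  refine ⟨K, K.2, δ, hδ, fun y hy z hz => ?_⟩
  have hconv : Convex ℝ (ball s δ ∩ closedBall y ‖z - y‖) :=
    (convex_ball s δ).inter (convex_closedBall y _)
  have h := hconv.norm_image_sub_le_of_norm_fderiv_le' (𝕜 := ℝ) (f := F)
    (φ := fderiv ℝ F y) (C := K * ‖z - y‖)
    (fun w _ => (hF.differentiable (by norm_num)).differentiableAt)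
    (fun w hw => ?_) (x := y) (y := z) ⟨hy, by simp⟩ ⟨hz, by simp [dist_eq_norm]⟩
  · rw [← Real.norm_eq_abs, pow_two, ← mul_assoc]
    exact h
  · have h1 := hK.dist_le_mul w (hball hw.1) y (hball hy)
    rw [dist_eq_norm] at h1
    exact h1.trans (mul_le_mul_of_nonneg_left (mem_closedBall.1 hw.2) K.2)

/-- Lagrange condition: the vector from a nearest point `y` of a regular level set to `x` is normal
to the level set at `y`. -/
lemma exists_inner_eq_mul_fderiv_of_dist_eq_infDist {E : Type*} [NormedAddCommGroup E]
    [InnerProductSpace ℝ E] [CompleteSpace E] {F : E → ℝ} (hF : ContDiff ℝ 1 F) {x y : E}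
    (hy : F y = 0) (hF' : fderiv ℝ F y ≠ 0) (hxy : dist x y = infDist x (F ⁻¹' {0})) :
    ∃ c : ℝ, innerSL ℝ (x - y) = c • fderiv ℝ F y := by
  have hmin : IsLocalExtrOn (fun w => ‖w - x‖ ^ 2) {w | F w = F y} y := by
    refine Or.inl (IsMinOn.localize fun w hw => ?_)
    have h : dist x y ≤ dist x w := hxy ▸ infDist_le_dist_of_mem (by simpa [hy] using hw)
    rw [dist_comm x, dist_comm x, dist_eq_norm, dist_eq_norm] at h
    exact pow_le_pow_left₀ (norm_nonneg _) h 2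
  have hstrict : HasStrictFDerivAt (fun w => ‖w - x‖ ^ 2) (2 • innerSL ℝ (y - x)) y := by
    simpa using (hasStrictFDerivAt_norm_sq (y - x)).comp y ((hasStrictFDerivAt_id y).sub_const x)
  obtain ⟨a, b, hab, h⟩ := hmin.exists_multipliers_of_hasStrictFDerivAt_1d
    (hF.contDiffAt.hasStrictFDerivAt (by norm_num)) hstrict
  have hb : b ≠ 0 := by
    rintro rfl
    have ha : a ≠ 0 := by rintro rfl; exact hab rfl
    simp_all
  refine ⟨a / (2 * b), ?_⟩
  ext v
  have hv := DFunLike.congr_fun h v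
  simp only [add_apply, smul_apply, innerSL_apply_apply,
    smul_eq_mul, nsmul_eq_mul, zero_apply, inner_sub_left, Nat.cast_ofNat]
    at hv ⊢
  field_simp
  linarith

/-- Near a regular point of a `C²` level set, nearest points in the level set are unique. -/
lemma exists_ball_nearest_unique {E : Type*} [NormedAddCommGroup E]
    [InnerProductSpace ℝ E] [CompleteSpace E] {F : E → ℝ} (hF : ContDiff ℝ 2 F) {s : E}
    (hs : F s = 0) (hF' : fderiv ℝ F s ≠ 0) :
    ∃ δ > 0, ∀ x ∈ ball s δ, ∀ y z, F y = 0 → F z = 0 → dist x y = infDist x (F ⁻¹' {0}) →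
      dist x z = infDist x (F ⁻¹' {0}) → y = z := by
  obtain ⟨K, hK, δ₁, hδ₁, htaylor⟩ := exists_ball_abs_sub_sub_fderiv_le hF s
  set m := ‖fderiv ℝ F s‖ / 2 with hm
  have hm0 : 0 < m := by positivity
  have hcont : Continuous fun w => ‖fderiv ℝ F w‖ := (hF.continuous_fderiv (by norm_num)).norm
  obtain ⟨δ₂, hδ₂, hgrad⟩ := Metric.mem_nhds_iff.1
    (hcont.continuousAt.eventually_const_lt (show m < ‖fderiv ℝ F s‖ by linarith))
  refine ⟨min (min δ₁ δ₂ / 2) (m / (2 * K + 1)), by positivity, fun x hx y z hy hz hxy hxz => ?_⟩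
  obtain ⟨hx1, hx2⟩ := lt_min_iff.1 (mem_ball.1 hx)
  have hle : infDist x (F ⁻¹' {0}) ≤ dist x s := infDist_le_dist_of_mem (by simpa using hs)
  have hnear : ∀ w, dist x w = infDist x (F ⁻¹' {0}) → dist w s < min δ₁ δ₂ := fun w hw => by
    linarith [dist_triangle_left w s x]
  obtain ⟨hy1, hy2⟩ := lt_min_iff.1 (hnear y hxy)
  have hmy : m < ‖fderiv ℝ F y‖ := hgrad (mem_ball.2 hy2)
  obtain ⟨c, hc⟩ := exists_inner_eq_mul_fderiv_of_dist_eq_infDist (hF.of_le (by norm_num)) hy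
    (norm_pos_iff.1 (hm0.trans hmy)) hxy
  have hT := htaylor y (mem_ball.2 hy1) z (mem_ball.2 ((hnear z hxz).trans_le (min_le_left _ _)))
  rw [hy, hz, sub_zero, zero_sub, abs_neg] at hT
  have hcnorm : ‖x - y‖ = |c| * ‖fderiv ℝ F y‖ := by
    rw [← innerSL_apply_norm (𝕜 := ℝ), hc, norm_smul, Real.norm_eq_abs]
  have hinner : ‖z - y‖ ^ 2 = 2 * (c * fderiv ℝ F y (z - y)) := by
    have h1 : inner ℝ (x - y) (z - y) = c * fderiv ℝ F y (z - y) :=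
      DFunLike.congr_fun hc (z - y)
    have h2 : ‖x - z‖ = ‖x - y‖ := by rw [← dist_eq_norm, ← dist_eq_norm, hxy, hxz]
    have h3 := norm_sub_sq_real (x - y) (z - y)
    rw [sub_sub_sub_cancel_right, h2] at h3
    linarith
  have hbound : ‖z - y‖ ^ 2 ≤ 2 * |c| * K * ‖z - y‖ ^ 2 := by
    calc ‖z - y‖ ^ 2 ≤ 2 * (|c| * |fderiv ℝ F y (z - y)|) := by
          rw [hinner, ← abs_mul]; gcongr; exact le_abs_self _
      _ ≤ 2 * (|c| * (K * ‖z - y‖ ^ 2)) := by gcongr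
      _ = _ := by ring
  have hsmall : 2 * |c| * K < 1 := by
    rw [lt_div_iff₀ (by positivity)] at hx2
    have hr : |c| * m ≤ dist x s := by
      rw [← hxy, dist_eq_norm, hcnorm] at hle
      exact (mul_le_mul_of_nonneg_left hmy.le (abs_nonneg c)).trans hle
    have h4 : |c| * m * (2 * K + 1) < m :=
      (mul_le_mul_of_nonneg_right hr (by positivity)).trans_lt hx2
    have h5 : |c| * (2 * K + 1) < 1 := by
      refine lt_of_mul_lt_mul_left ?_ hm0.le
      linarith
    nlinarith [abs_nonneg c]
  by_contra hne
  have hpos : 0 < ‖z - y‖ ^ 2 := by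
    have := norm_pos_iff.2 (sub_ne_zero.2 (Ne.symm hne))
    positivity
  nlinarith

/-- A regular `C²` level set does not meet its medial axis. -/
lemma notMem_medialAxis_of_fderiv_ne_zero {F : EuclideanSpace ℝ (Fin 3) → ℝ}
    (hF : ContDiff ℝ 2 F) {s : EuclideanSpace ℝ (Fin 3)} (hs : F s = 0)
    (hF' : fderiv ℝ F s ≠ 0) : s ∉ medialAxis (F ⁻¹' {0}) := by
  obtain ⟨δ, hδ, huniq⟩ := exists_ball_nearest_unique hF hs hF'
  intro hmem
  obtain ⟨x, ⟨y, hy, z, hz, hne, hxy, hxz⟩, hx⟩ := Metric.mem_closure_iff.1 hmem δ hδ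
  exact hne (huniq x (mem_ball'.2 hx) y z hy hz hxy hxz)

/-- If `q ∈ Σ`, `0 < ε < 1/2` and `dist q p ≤ ε · f q`, then any nearest point
`p̃` of `p` in `Σ` satisfies `dist p p̃ ≤ (2ε/(1-2ε)) · f p̃`; moreover, for
`ε < 1/3`, `dist p p̃ < f p̃`. -/
theorem offset_distance_lt_lfs
    (F : EuclideanSpace ℝ (Fin 3) → ℝ) (hF : ContDiff ℝ (⊤ : ℕ∞) F)
    (S : Set (EuclideanSpace ℝ (Fin 3))) (hS : S = F ⁻¹' {0})
    (hScomp : IsCompact S)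
    (hgrad : ∀ p ∈ S, gradient F p ≠ 0)
    (M : Set (EuclideanSpace ℝ (Fin 3))) (hM : M = medialAxis S)
    (hMne : M.Nonempty)
    (f : EuclideanSpace ℝ (Fin 3) → ℝ) (hf : ∀ x, f x = Metric.infDist x M)
    (q : EuclideanSpace ℝ (Fin 3)) (hq : q ∈ S)
    (ε : ℝ) (hε0 : 0 < ε) (hε : ε < 1/2)
    (p : EuclideanSpace ℝ (Fin 3)) (hd : dist q p ≤ ε * f q)
    (pt : EuclideanSpace ℝ (Fin 3)) (hpt : pt ∈ S)
    (hptn : dist p pt = Metric.infDist p S) :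
    dist p pt ≤ (2 * ε / (1 - 2 * ε)) * f pt ∧
    (ε < 1/3 → dist p pt < f pt) := by
  have hpos : 0 < f pt := by
    subst hS hM
    rw [hf]
    refine (IsClosed.notMem_iff_infDist_pos isClosed_closure hMne).1 ?_
    refine notMem_medialAxis_of_fderiv_ne_zero (contDiff_infty.1 hF 2) hpt fun h => ?_
    exact hgrad pt hpt (by simp [gradient, h])
  have hle : dist p pt ≤ dist q p := by
    rw [hptn, dist_comm q p]
    exact infDist_le_dist_of_mem hq
  have hlip : f q ≤ f pt + dist q pt := by
    rw [hf, hf]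
    exact infDist_le_infDist_add_dist
  have htri := dist_triangle q p pt
  have hfq : (1 - 2 * ε) * f q ≤ f pt := by linarith
  have hden : 0 < 1 - 2 * ε := by linarith
  have hmain : dist p pt * (1 - 2 * ε) ≤ ε * f pt := by
    nlinarith [mul_le_mul_of_nonneg_left hfq hε0.le,
      mul_le_mul_of_nonneg_right (hle.trans hd) hden.le]
  refine ⟨?_, fun hε3 => ?_⟩
  · rw [div_mul_eq_mul_div, le_div_iff₀ hden]
    nlinarith
  · refine lt_of_mul_lt_mul_right (hmain.trans_lt ?_) hden.le
    nlinarith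
end

section
/- Let v : ℝ → ℝ³ be continuously differentiable on the interval [a,b] with a ≤ b, suppose ‖v(t)‖ = 1 for all t ∈ [a,b], and suppose ‖v'(t)‖ ≤ κ for all t ∈ [a,b], where κ ≥ 0. Then the angle between v(a) and v(b) satisfies ∠(v(a), v(b)) ≤ κ·(b-a). -/
open Set

/-- A vector field of constant norm on `[a, b]` is orthogonal to its derivative. -/
lemma inner_deriv_eq_zero_of_norm_eq_const {E : Type*} [NormedAddCommGroup E]
    [InnerProductSpace ℝ E] {v : ℝ → E} {w : E} {a b t r : ℝ} (hab : a < b)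
    (ht : t ∈ Icc a b) (hnorm : ∀ s ∈ Icc a b, ‖v s‖ = r)
    (hv : HasDerivWithinAt v w (Icc a b) t) : inner ℝ (v t) w = 0 := by
  have hconst : HasDerivWithinAt (fun s => ‖v s‖ ^ 2) 0 (Icc a b) t :=
    (hasDerivWithinAt_const t (Icc a b) (r ^ 2)).congr
      (fun s hs => by rw [hnorm s hs]) (by rw [hnorm t ht])
  have heq := (uniqueDiffOn_Icc hab t ht).eq_deriv _ hv.norm_sq hconst
  linarith

/-- For unit vectors `x`, `y` at angle `θ` and `w` orthogonal to `y`, the component of `w`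
along `x` has absolute value at most `sin θ * ‖w‖`. -/
lemma abs_inner_le_sin_mul_norm {E : Type*} [NormedAddCommGroup E] [InnerProductSpace ℝ E]
    {x y w : E} {θ : ℝ} (hx : ‖x‖ = 1) (hy : ‖y‖ = 1) (hyw : inner ℝ y w = 0)
    (hθ : inner ℝ x y = Real.cos θ) (hsin : 0 ≤ Real.sin θ) :
    |inner ℝ x w| ≤ Real.sin θ * ‖w‖ := by
  have hnorm : ‖x - Real.cos θ • y‖ = Real.sin θ := by
    rw [← sq_eq_sq₀ (norm_nonneg _) hsin, norm_sub_sq_real, inner_smul_right, hθ, norm_smul,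
      hx, hy, Real.norm_eq_abs, mul_one, sq_abs, Real.sin_sq]
    ring
  have hinner : inner ℝ x w = inner ℝ (x - Real.cos θ • y) w := by
    rw [inner_sub_left, real_inner_smul_left, hyw, mul_zero, sub_zero]
  rw [hinner, ← hnorm]
  exact abs_real_inner_le_norm _ _

/-- A unit vector field whose derivative has norm at most `κ` turns by at most any
`δ + (κ + δ) * (b - a) < π` with `δ > 0`. -/
lemma angle_le_of_deriv_bound_add {E : Type*} [NormedAddCommGroup E] [InnerProductSpace ℝ E]
    {v v' : ℝ → E} {a b κ δ : ℝ} (hab : a ≤ b) (hκ : 0 ≤ κ) (hδ : 0 < δ)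
    (hunit : ∀ t ∈ Icc a b, ‖v t‖ = 1)
    (hv : ∀ t ∈ Icc a b, HasDerivWithinAt v (v' t) (Icc a b) t)
    (hv' : ∀ t ∈ Icc a b, ‖v' t‖ ≤ κ) (hπ : δ + (κ + δ) * (b - a) < Real.pi) :
    InnerProductGeometry.angle (v a) (v b) ≤ δ + (κ + δ) * (b - a) := by
  have ha := left_mem_Icc.2 hab
  have hb := right_mem_Icc.2 hab
  have hfence : -inner ℝ (v a) (v b) ≤ -Real.cos (δ + (κ + δ) * (b - a)) := by
    refine image_le_of_deriv_right_lt_deriv_boundary (f := fun t => -inner ℝ (v a) (v t))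
      (f' := fun t => -inner ℝ (v a) (v' t)) (B := fun t => -Real.cos (δ + (κ + δ) * (t - a)))
      (B' := fun t => Real.sin (δ + (κ + δ) * (t - a)) * (κ + δ)) ?_ ?_ ?_ ?_ ?_ hb
    · exact (continuousOn_const.inner fun t ht => (hv t ht).continuousWithinAt).neg
    · intro t ht
      have hderiv := (hv t (Ico_subset_Icc_self ht)).mono_of_mem_nhdsWithin
        (Icc_mem_nhdsGE_of_mem ht)
      simpa using ((hasDerivWithinAt_const t (Ici t) (v a)).inner ℝ hderiv).fun_neg
    · simpa [real_inner_self_eq_norm_sq, hunit a ha] using Real.cos_le_one δ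
    · intro t
      have hlin : HasDerivAt (fun t => δ + (κ + δ) * (t - a)) (κ + δ) t := by
        simpa using (((hasDerivAt_id t).sub_const a).const_mul (κ + δ)).const_add δ
      simpa using hlin.cos.fun_neg
    · intro t ht heq
      have ht' := Ico_subset_Icc_self ht
      have hpos : 0 < δ + (κ + δ) * (t - a) := by
        have := mul_nonneg (add_nonneg hκ hδ.le) (sub_nonneg.2 ht.1)
        linarith
      have hlt : δ + (κ + δ) * (t - a) < Real.pi := by
        refine lt_of_le_of_lt ?_ hπ
        gcongr
        exact ht.2.le
      have hsin := Real.sin_pos_of_pos_of_lt_pi hpos hlt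
      have horth := inner_deriv_eq_zero_of_norm_eq_const (ht.1.trans_lt ht.2) ht' hunit (hv t ht')
      calc -inner ℝ (v a) (v' t) ≤ |inner ℝ (v a) (v' t)| := neg_le_abs _
        _ ≤ Real.sin (δ + (κ + δ) * (t - a)) * ‖v' t‖ :=
          abs_inner_le_sin_mul_norm (hunit a ha) (hunit t ht') horth (neg_injective heq) hsin.le
        _ < Real.sin (δ + (κ + δ) * (t - a)) * (κ + δ) := by
          gcongr
          linarith [hv' t ht']
  have hnonneg : 0 ≤ δ + (κ + δ) * (b - a) := by
    have := mul_nonneg (add_nonneg hκ hδ.le) (sub_nonneg.2 hab)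
    linarith
  rw [InnerProductGeometry.angle, hunit a ha, hunit b hb, mul_one, div_one,
    ← Real.arccos_cos hnonneg hπ.le]
  exact Real.arccos_le_arccos (neg_le_neg_iff.1 hfence)

/-- The turning of a `C¹` unit vector field along an interval is bounded by the
maximum norm of its derivative times the length of the interval: if
`‖v t‖ = 1` and `‖v' t‖ ≤ κ` on `[a,b]`, then `∠(v a, v b) ≤ κ·(b-a)`. -/
theorem angle_le_of_deriv_bound
    (v : ℝ → EuclideanSpace ℝ (Fin 3)) (a b : ℝ) (hab : a ≤ b)
    (hv : ContDiffOn ℝ 1 v (Set.Icc a b))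
    (hunit : ∀ t ∈ Set.Icc a b, ‖v t‖ = 1)
    (κ : ℝ) (hκ : 0 ≤ κ)
    (hderiv : ∀ t ∈ Set.Icc a b, ‖derivWithin v (Set.Icc a b) t‖ ≤ κ) :
    InnerProductGeometry.angle (v a) (v b) ≤ κ * (b - a) := by
  refine le_of_forall_gt_imp_ge_of_dense fun s hs => ?_
  rcases le_or_gt Real.pi s with hπ | hπ
  · exact (InnerProductGeometry.angle_le_pi _ _).trans hπ
  have hlen : 0 < 1 + (b - a) := by linarith
  obtain ⟨δ, hδ⟩ : ∃ δ, δ = (s - κ * (b - a)) / (1 + (b - a)) := ⟨_, rfl⟩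
  have hδ_pos : 0 < δ := hδ ▸ div_pos (sub_pos.2 hs) hlen
  have hs_eq : δ + (κ + δ) * (b - a) = s := by
    rw [eq_div_iff hlen.ne'] at hδ
    linarith
  rw [← hs_eq] at hπ ⊢
  exact angle_le_of_deriv_bound_add hab hκ hδ_pos hunit
    (fun t ht => (hv.differentiableOn one_ne_zero t ht).hasDerivWithinAt) hderiv hπ
end

section
/- Let F ⊂ ℝ³ be a compact smooth surface (the zero level set of a smooth function with nonvanishing gradient on it) and let q ∈ F. For x, y ∈ F let d_F(x,y) denote the geodesic (intrinsic) distance: the infimum of the lengths of continuous paths γ : [0,1] → ℝ³ with γ(0) = x, γ(1) = y, and γ(t) ∈ F for all t, where the length of γ is its total variation eVariationOn γ [0,1]. Then d_F(q,q')/dist(q,q') tends to 1 as q' → q with q' ∈ F, q' ≠ q; that is, for every δ > 0 there exists η > 0 such that for all q' ∈ F with 0 < dist(q,q') < η, one has dist(q,q') ≤ d_F(q,q') ≤ (1+δ)·dist(q,q'). -/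
open Metric Set ENNReal

/-- The geodesic (intrinsic) distance between two points of a set
`F ⊆ ℝ³`: the infimum of the lengths (total variations on `[0,1]`) of
continuous paths joining them inside `F`. -/
noncomputable def geodesicDist (F : Set (EuclideanSpace ℝ (Fin 3)))
    (x y : EuclideanSpace ℝ (Fin 3)) : ℝ≥0∞ :=
  ⨅ (γ : ℝ → EuclideanSpace ℝ (Fin 3))
    (_ : Continuous γ) (_ : γ 0 = x) (_ : γ 1 = y)
    (_ : ∀ t ∈ Set.Icc (0:ℝ) 1, γ t ∈ F),
    eVariationOn γ (Set.Icc 0 1)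

open Filter Topology NNReal

theorem edist_le_geodesicDist (F : Set (EuclideanSpace ℝ (Fin 3)))
    (x y : EuclideanSpace ℝ (Fin 3)) : edist x y ≤ geodesicDist F x y := by
  refine le_iInf fun γ => le_iInf fun _ => le_iInf fun h0 => le_iInf fun h1 => le_iInf fun _ => ?_
  rw [← h0, ← h1]
  exact eVariationOn.edist_le γ (by simp) (by simp)

/-- A `C`-Lipschitz path in `F` bounds the geodesic distance between its endpoints by `C`. -/
theorem geodesicDist_le_of_lipschitzWith {F : Set (EuclideanSpace ℝ (Fin 3))} {C : ℝ≥0}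
    {γ : ℝ → EuclideanSpace ℝ (Fin 3)} (hγ : LipschitzWith C γ)
    (hmem : ∀ t ∈ Icc (0 : ℝ) 1, γ t ∈ F) : geodesicDist F (γ 0) (γ 1) ≤ C := by
  refine iInf_le_of_le γ <| iInf_le_of_le hγ.continuous <| iInf_le_of_le rfl <|
    iInf_le_of_le rfl <| iInf_le_of_le hmem ?_
  calc eVariationOn (γ ∘ id) (Icc 0 1)
      ≤ C * eVariationOn (id : ℝ → ℝ) (Icc 0 1) :=
        (hγ.lipschitzOnWith (s := univ)).comp_eVariationOn_le (mapsTo_univ _ _)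
    _ = C := by simp

/-- The image of the segment from `0` to `u` under a map that is `K`-Lipschitz near it is a path
of length at most `K * ‖u‖`. -/
theorem geodesicDist_le_of_lipschitzOnWith_ball {V : Type*} [NormedAddCommGroup V]
    [NormedSpace ℝ V] {F : Set (EuclideanSpace ℝ (Fin 3))} {K : ℝ≥0} {r : ℝ}
    {φ : V → EuclideanSpace ℝ (Fin 3)} (hφ : LipschitzOnWith K φ (ball 0 r))
    (hmem : ∀ v ∈ ball (0 : V) r, φ v ∈ F) {u : V} (hu : u ∈ ball (0 : V) r) :
    geodesicDist F (φ 0) (φ u) ≤ ENNReal.ofReal (K * ‖u‖) := by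
  have hball : ∀ t : Icc (0 : ℝ) 1, (t : ℝ) • u ∈ ball (0 : V) r := fun t => by
    rw [mem_ball_zero_iff] at hu ⊢
    rw [norm_smul, Real.norm_of_nonneg t.2.1]
    exact (mul_le_of_le_one_left (norm_nonneg u) t.2.2).trans_lt hu
  have hseg : LipschitzWith ‖u‖₊ fun t : Icc (0 : ℝ) 1 => (t : ℝ) • u :=
    LipschitzWith.of_dist_le_mul fun s t => by
      rw [dist_eq_norm, ← sub_smul, norm_smul, mul_comm, Subtype.dist_eq, Real.dist_eq,
        coe_nnnorm, Real.norm_eq_abs]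
  have hpath : LipschitzWith (K * ‖u‖₊)
      fun t : ℝ => φ ((projIcc (0 : ℝ) 1 zero_le_one t : ℝ) • u) := by
    have h := hφ.comp (hseg.lipschitzOnWith (s := univ)) fun t _ => hball t
    simpa [Function.comp_def] using
      (lipschitzOnWith_univ.1 h).comp (LipschitzWith.projIcc zero_le_one)
  have h := geodesicDist_le_of_lipschitzWith hpath fun t _ => hmem _ (hball _)
  rw [← coe_nnnorm, ← NNReal.coe_mul, ENNReal.ofReal_coe_nnreal]
  simpa using h

/-- Proposition 1 of the paper: on a compact smooth surface `F = G⁻¹({0})`,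
the ratio of geodesic to Euclidean distance tends to `1`: for every `δ > 0`
there is `η > 0` such that for `q' ∈ F` with `0 < dist q q' < η`, one has
`dist q q' ≤ d_F(q,q') ≤ (1+δ)·dist q q'`. -/
theorem geodesic_dist_ratio_to_one
    (G : EuclideanSpace ℝ (Fin 3) → ℝ) (hG : ContDiff ℝ (⊤ : ℕ∞) G)
    (F : Set (EuclideanSpace ℝ (Fin 3))) (hF : F = G ⁻¹' {0})
    (hFcomp : IsCompact F)
    (hgrad : ∀ p ∈ F, gradient G p ≠ 0)
    (q : EuclideanSpace ℝ (Fin 3)) (hq : q ∈ F) :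
    ∀ δ : ℝ, 0 < δ → ∃ η : ℝ, 0 < η ∧
      ∀ q' ∈ F, 0 < dist q q' → dist q q' < η →
        ENNReal.ofReal (dist q q') ≤ geodesicDist F q q' ∧
        geodesicDist F q q' ≤ ENNReal.ofReal ((1 + δ) * dist q q') := by
  intro δ hδ
  have hG0 : G q = 0 := by simpa [hF] using hq
  have hstrict : HasStrictFDerivAt G (fderiv ℝ G q) q :=
    hG.contDiffAt.hasStrictFDerivAt (by simp)
  have hne : fderiv ℝ G q ≠ 0 := fun h => hgrad q hq (by simp [gradient, h])
  have hrange : (fderiv ℝ G q).range = ⊤ :=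
    Module.Dual.range_eq_top_of_ne_zero fun h => hne (by ext v; exact DFunLike.congr_fun h v)
  set φ := hstrict.implicitFunction G (fderiv ℝ G q) hrange 0
  have hφ0 : φ 0 = q := by
    simpa [hG0] using hstrict.implicitFunction_apply_image hrange
  have hφ' : HasStrictFDerivAt φ (fderiv ℝ G q).ker.subtypeL 0 := by
    simpa [hG0] using hstrict.to_implicitFunction hrange
  -- This constant satisfies `(1 + c) / (1 - c) = 1 + δ`.
  obtain ⟨c, hc⟩ : ∃ c : ℝ≥0, (c : ℝ) = δ / (2 + δ) := ⟨⟨δ / (2 + δ), by positivity⟩, rfl⟩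
  have hcpos : 0 < c := by rw [← NNReal.coe_pos, hc]; positivity
  obtain ⟨s, hs, happrox⟩ := hφ'.approximates_deriv_on_nhds (c := c) (Or.inr hcpos)
  have hlevel : ∀ᶠ v in 𝓝 (0 : (fderiv ℝ G q).ker), φ v ∈ F := by
    have h := hstrict.map_implicitFunction_eq hrange
    rw [hG0] at h
    have ht : Tendsto (fun v : (fderiv ℝ G q).ker => ((0 : ℝ), v)) (𝓝 0) (𝓝 (0, 0)) :=
      tendsto_const_nhds.prodMk_nhds tendsto_id
    filter_upwards [ht.eventually h] with v hv
    simpa [hF] using hv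
  obtain ⟨r, hr, hball⟩ := Metric.eventually_nhds_iff_ball.1 (hlevel.and hs)
  have hdist : ∀ v ∈ ball 0 r, ∀ w ∈ ball 0 r,
      ‖φ v - φ w - ((v - w :) : EuclideanSpace ℝ (Fin 3))‖ ≤ c * ‖v - w‖ := fun v hv w hw => happrox v (hball v hv).2 w (hball w hw).2
  have hlip : LipschitzOnWith (1 + c) φ (ball 0 r) := by
    refine LipschitzOnWith.of_dist_le_mul fun v hv w hw => ?_
    have h1 := hdist v hv w hw
    have h2 := norm_le_norm_sub_add (φ v - φ w) ((v - w :) : EuclideanSpace ℝ (Fin 3))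
    rw [← Submodule.coe_norm] at h2
    rw [dist_eq_norm, dist_eq_norm]
    push_cast
    linarith
  have hchart : ∀ᶠ x in 𝓝 q, x ∈ F → ∃ u ∈ ball (0 : (fderiv ℝ G q).ker) r, φ u = x := by
    set e := hstrict.implicitToOpenPartialHomeomorph G (fderiv ℝ G q) hrange with he
    have hcont : Tendsto (fun x => (e x).2) (𝓝 q) (𝓝 0) := by
      have h := (e.continuousAt (hstrict.mem_implicitToOpenPartialHomeomorph_source hrange)).snd
      simpa [ContinuousAt, he] using h
    filter_upwards [hstrict.eq_implicitFunction hrange, hcont.eventually (ball_mem_nhds 0 hr)]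
      with x hx hxr hxF
    have hGx : G x = 0 := by simpa [hF] using hxF
    exact ⟨_, hxr, by rwa [hGx] at hx⟩
  obtain ⟨η, hη, hη'⟩ := Metric.eventually_nhds_iff.1 hchart
  refine ⟨η, hη, fun q' hq' _ hlt => ⟨?_, ?_⟩⟩
  · rw [← edist_dist]
    exact edist_le_geodesicDist F q q'
  · obtain ⟨u, hu, rfl⟩ := hη' (by rwa [dist_comm]) hq'
    have hle := geodesicDist_le_of_lipschitzOnWith_ball hlip (fun v hv => (hball v hv).1) hu
    rw [hφ0] at hle
    refine hle.trans (ENNReal.ofReal_le_ofReal ?_)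
    have h1 := hdist u hu 0 (mem_ball_self hr)
    have h2 := norm_le_norm_add_norm_sub' (u : EuclideanSpace ℝ (Fin 3)) (φ u - q)
    rw [hφ0, sub_zero] at h1
    rw [norm_sub_rev (u : EuclideanSpace ℝ (Fin 3)), ← Submodule.coe_norm] at h2
    have h3 : (1 - c) * ‖u‖ ≤ dist q (φ u) := by
      rw [dist_comm, dist_eq_norm]
      linarith
    have h4 : (1 + c : ℝ) = (1 + δ) * (1 - c) := by rw [hc]; field_simp; ring
    push_cast
    rw [h4, mul_assoc]
    gcongr
end

section
/- Let S ⊂ ℝ³ be a compact smooth surface realized as a regular level set S = h⁻¹({ω}) of a C¹ function h : ℝ³ → ℝ with derivative nonvanishing on S, and let p ∈ S. Then for every δ > 0 there exists η > 0 such that for every point p' ∈ ℝ³ with dist(p,p') < η, every nearest point r of p' in S (i.e., r ∈ S with dist(p',r) = infDist p' S) satisfies dist(p,r) ≤ (1+δ)·dist(p,p'). -/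
open Metric Set

open Topology in
/-- Chords of a level set through a regular point are asymptotically tangent to it. -/
lemma eventually_abs_fderiv_sub_le {E : Type*} [NormedAddCommGroup E] [NormedSpace ℝ E]
    {h : E → ℝ} (hh : ContDiff ℝ 1 h) {p : E} (hp : fderiv ℝ h p ≠ 0) {ε : ℝ} (hε : 0 < ε) :
    ∀ᶠ r in 𝓝 p, h r = h p → |fderiv ℝ h r (p - r)| ≤ ε * ‖fderiv ℝ h r‖ * ‖p - r‖ := by
  have hm : 0 < ‖fderiv ℝ h p‖ := norm_pos_iff.2 hp
  set m := ‖fderiv ℝ h p‖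
  have hcont : ContinuousAt (fderiv ℝ h) p := (hh.continuous_fderiv one_ne_zero).continuousAt
  have hdiffAt : HasFDerivAt h (fderiv ℝ h p) p :=
    (hh.differentiable one_ne_zero p).hasFDerivAt
  have hκ : 0 < ε * m / 4 := by positivity
  have hnorm : ∀ᶠ r in 𝓝 p, m / 2 < ‖fderiv ℝ h r‖ :=
    hcont.norm.eventually (lt_mem_nhds (half_lt_self hm))
  filter_upwards [hdiffAt.isLittleO.def hκ, hnorm, hcont.eventually (ball_mem_nhds _ hκ)]
    with r hr hmr hball heq
  rw [heq, sub_self, zero_sub, norm_neg, Real.norm_eq_abs, norm_sub_rev] at hr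
  have hflip : |fderiv ℝ h p (p - r)| ≤ ε * m / 4 * ‖p - r‖ := by
    rwa [← neg_sub r p, map_neg, abs_neg, neg_sub]
  have hdiff : |(fderiv ℝ h r - fderiv ℝ h p) (p - r)| ≤ ε * m / 4 * ‖p - r‖ :=
    (fderiv ℝ h r - fderiv ℝ h p).le_of_opNorm_le (mem_ball_iff_norm.1 hball).le _
  calc |fderiv ℝ h r (p - r)|
      = |(fderiv ℝ h r - fderiv ℝ h p) (p - r) + fderiv ℝ h p (p - r)| := by simp
    _ ≤ ε * m / 4 * ‖p - r‖ + ε * m / 4 * ‖p - r‖ :=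
        (abs_add_le _ _).trans (add_le_add hdiff hflip)
    _ = ε * (m / 2) * ‖p - r‖ := by ring
    _ ≤ ε * ‖fderiv ℝ h r‖ * ‖p - r‖ := by gcongr

/-- The segment from a point to its nearest point on a regular level set is normal to it. -/
lemma exists_innerSL_eq_smul_fderiv_of_dist_eq_infDist {E : Type*} [NormedAddCommGroup E]
    [InnerProductSpace ℝ E] [CompleteSpace E] {h : E → ℝ} (hh : ContDiff ℝ 1 h) {q r : E}
    (hr : fderiv ℝ h r ≠ 0) (hmin : dist q r = infDist q (h ⁻¹' {h r})) :
    ∃ c : ℝ, innerSL ℝ (r - q) = c • fderiv ℝ h r := by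
  have hφ : HasStrictFDerivAt (fun x => ‖x - q‖ ^ 2) (2 • innerSL ℝ (r - q)) r := by
    simpa [Function.comp_def, ContinuousLinearMap.comp_id] using
      (hasStrictFDerivAt_norm_sq (r - q)).comp r ((hasStrictFDerivAt_id r).sub_const q)
  have hloc : IsLocalMinOn (fun x => ‖x - q‖ ^ 2) {x | h x = h r} r := by
    refine IsMinOn.localize fun x hx => ?_
    have : dist q r ≤ dist q x := hmin ▸ infDist_le_dist_of_mem hx
    rw [dist_comm q r, dist_comm q x, dist_eq_norm, dist_eq_norm] at this
    simp only [mem_ofPred_eq]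
    gcongr
  obtain ⟨a, b, hab, heq⟩ := IsLocalExtrOn.exists_multipliers_of_hasStrictFDerivAt_1d
    (Or.inl hloc) (hh.contDiffAt.hasStrictFDerivAt one_ne_zero) hφ
  have hb : b ≠ 0 := by
    rintro rfl
    have : a = 0 := by simpa [hr] using heq
    simp [this] at hab
  refine ⟨-a / (2 * b), ContinuousLinearMap.ext fun v => ?_⟩
  have hv := congrArg (fun L => L v) heq
  simp at hv ⊢
  field_simp
  linarith

/-- If the angle at `r` has cosine at most `ε`, the opposite side bounds the adjacent one. -/
lemma one_sub_sq_mul_norm_sub_sq_le {E : Type*} [NormedAddCommGroup E]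
    [InnerProductSpace ℝ E] {p q r : E} {ε : ℝ}
    (hin : |inner ℝ (r - q) (p - r)| ≤ ε * ‖r - q‖ * ‖p - r‖) :
    (1 - ε ^ 2) * ‖p - r‖ ^ 2 ≤ ‖p - q‖ ^ 2 := by
  have hexp := norm_add_sq_real (r - q) (p - r)
  rw [add_comm, sub_add_sub_cancel] at hexp
  nlinarith [neg_le_of_abs_le hin, sq_nonneg (‖r - q‖ - ε * ‖p - r‖)]

/-- Claim 3 of the paper: let `S = h⁻¹({ω})` be a compact regular level set of
a `C¹` function `h : ℝ³ → ℝ` whose derivative does not vanish on `S`, and let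
`p ∈ S`. For every `δ > 0` there is `η > 0` such that whenever
`dist p p' < η`, every nearest point `r` of `p'` in `S` satisfies
`dist p r ≤ (1+δ)·dist p p'`. -/
theorem nearest_point_close
    (h : EuclideanSpace ℝ (Fin 3) → ℝ) (hh : ContDiff ℝ 1 h) (ω : ℝ)
    (S : Set (EuclideanSpace ℝ (Fin 3))) (hS : S = h ⁻¹' {ω})
    (hScomp : IsCompact S) (hSne : S.Nonempty)
    (hderiv : ∀ x ∈ S, fderiv ℝ h x ≠ 0)
    (p : EuclideanSpace ℝ (Fin 3)) (hp : p ∈ S) :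
    ∀ δ : ℝ, 0 < δ → ∃ η : ℝ, 0 < η ∧
      ∀ p' : EuclideanSpace ℝ (Fin 3), dist p p' < η →
        ∀ r ∈ S, dist p' r = Metric.infDist p' S →
          dist p r ≤ (1 + δ) * dist p p' := by
  intro δ hδ
  subst hS
  set ε : ℝ := √(1 - 1 / (1 + δ) ^ 2)
  have hlt : 1 / (1 + δ) ^ 2 < 1 := by
    rw [div_lt_one (by positivity)]
    nlinarith
  have hε : 0 < ε := Real.sqrt_pos.2 (by linarith)
  have hεsq : 1 - ε ^ 2 = 1 / (1 + δ) ^ 2 := by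
    rw [Real.sq_sqrt (by linarith)]
    ring
  obtain ⟨ρ, hρ, hball⟩ := Metric.eventually_nhds_iff.1
    (eventually_abs_fderiv_sub_le hh (hderiv p hp) hε)
  refine ⟨ρ / 2, by positivity, fun p' hp' r hr hmin => ?_⟩
  have hle : dist p' r ≤ dist p' p := hmin ▸ infDist_le_dist_of_mem hp
  have hrp : dist r p < ρ := by
    linarith [dist_triangle_left r p p', dist_comm p p']
  have hrω : h r = ω := hr
  have htan := hball hrp (hrω.trans (Eq.symm hp))
  obtain ⟨c, hc⟩ := exists_innerSL_eq_smul_fderiv_of_dist_eq_infDist hh (hderiv r hr)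
    (hrω.symm ▸ hmin)
  have hnorm : ‖r - p'‖ = |c| * ‖fderiv ℝ h r‖ := by
    rw [← innerSL_apply_norm ℝ (r - p'), hc, norm_smul, Real.norm_eq_abs]
  have hin : |inner ℝ (r - p') (p - r)| ≤ ε * ‖r - p'‖ * ‖p - r‖ := by
    rw [← innerSL_apply_apply ℝ, hc, hnorm, smul_apply, smul_eq_mul, abs_mul]
    calc |c| * |fderiv ℝ h r (p - r)| ≤ |c| * (ε * ‖fderiv ℝ h r‖ * ‖p - r‖) := by gcongr
      _ = ε * (|c| * ‖fderiv ℝ h r‖) * ‖p - r‖ := by ring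
  have hfin := one_sub_sq_mul_norm_sub_sq_le hin
  rw [hεsq, one_div_mul_eq_div, div_le_iff₀ (by positivity), mul_comm, ← mul_pow] at hfin
  rw [dist_eq_norm, dist_eq_norm]
  exact (sq_le_sq₀ (by positivity) (by positivity)).1 hfin
end
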